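/- arXiv:1909.04284 — 3 statements merged into one kernel-verified Lean document; each statement's English description precedes it below -/
import Mathlib

section
/- Let p ≥ 3 be a prime, let q, k ≥ 1 be natural numbers and θ ∈ ℚ_p with |q|_p < |k|_p and |θ − 1|_p < |q|_p². Then for every x ∈ ℚ_p with x ≠ 2 − q − θ and x ∉ X, all iterates satisfy f^n(x) ≠ 2 − q − θ and f^n(x) → 1 as n → ∞. -/
open scoped Classical

/-- The Potts–Bethe mapping on `ℚ_[p]` (with total division, so defined everywhere). -/
noncomputable def pottsBethe (p : ℕ) [Fact p.Prime] (q k : ℕ) (θ : ℚ_[p]) : ℚ_[p] → ℚ_[p] :=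
  fun x => ((θ * x + (q : ℚ_[p]) - 1) / (x + θ + (q : ℚ_[p]) - 2)) ^ k

/-- The center `x_ξ` associated with a `k`-th root of unity `ξ`. -/
noncomputable def xiCenter (p : ℕ) [Fact p.Prime] (q k : ℕ) (θ ξ : ℚ_[p]) : ℚ_[p] :=
  if ξ = 1 then
    1 - (q : ℚ_[p]) + ((k : ℚ_[p]) - 1) *
      (1 - (q : ℚ_[p]) / 2 + ((k : ℚ_[p]) - 2) * (q : ℚ_[p]) ^ 2 / (6 * (k : ℚ_[p]))) * (θ - 1)
  else
    2 - (q : ℚ_[p]) - θ + (q : ℚ_[p]) * (θ - 1) / (1 - ξ)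

/-- The union `X` of the balls of radius `r = ‖q (θ - 1)‖` around the centers `x_ξ`. -/
def XSet (p : ℕ) [Fact p.Prime] (q k : ℕ) (θ : ℚ_[p]) : Set ℚ_[p] :=
  {x : ℚ_[p] | ∃ ξ : ℚ_[p], ξ ^ k = 1 ∧ ‖x - xiCenter p q k θ ξ‖ < ‖(q : ℚ_[p]) * (θ - 1)‖}

/-- The Julia set `J = ⋂_{n ≥ 1} f^{-n}(X)`. -/
noncomputable def JSet (p : ℕ) [Fact p.Prime] (q k : ℕ) (θ : ℚ_[p]) : Set ℚ_[p] :=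
  ⋂ n ∈ Set.Ici 1, (pottsBethe p q k θ)^[n] ⁻¹' XSet p q k θ


section
open Finset
variable {p : ℕ} [Fact p.Prime]

namespace PB
lemma add_lt {a b : ℚ_[p]} {c : ℝ} (ha : ‖a‖ < c) (hb : ‖b‖ < c) : ‖a + b‖ < c :=
  lt_of_le_of_lt (Padic.nonarchimedean a b) (max_lt ha hb)

lemma sub_lt {a b : ℚ_[p]} {c : ℝ} (ha : ‖a‖ < c) (hb : ‖b‖ < c) : ‖a - b‖ < c := by
  rw [sub_eq_add_neg]; exact add_lt ha (by rwa [norm_neg])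

lemma add_eq {a b : ℚ_[p]} (h : ‖b‖ < ‖a‖) : ‖a + b‖ = ‖a‖ := by
  rw [Padic.add_eq_max_of_ne h.ne', max_eq_left h.le]

lemma norm_third (hp : 3 ≤ p) {u : ℚ_[p]} (h : ‖u‖ < 1) : ‖u‖ ≤ 1 / 3 := by
  have h1 := (Padic.norm_le_pow_iff_norm_lt_pow_add_one u (-1)).2 (by simpa using h)
  refine h1.trans ?_
  have : (3 : ℝ) ≤ p := by exact_mod_cast hp
  rw [zpow_neg_one, ← one_div]
  exact one_div_le_one_div_of_le (by norm_num) this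

lemma norm_nat_ge {j : ℕ} (hj : j ≠ 0) : 1 ≤ ‖(j : ℚ_[p])‖ * j := by
  have hp : (0:ℝ) < p := by exact_mod_cast (Fact.out : p.Prime).pos
  have h1 : p ^ padicValNat p j ≤ j := Nat.le_of_dvd (Nat.pos_of_ne_zero hj) pow_padicValNat_dvd
  have h2 : ‖(j : ℚ_[p])‖ = ((p : ℝ) ^ padicValNat p j)⁻¹ := by
    rw [Padic.norm_eq_zpow_neg_valuation (by exact_mod_cast hj)]
    simp
  rw [h2]
  have h3 : ((p : ℝ) ^ padicValNat p j) ≤ j := by exact_mod_cast h1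
  have : 0 < ((p : ℝ) ^ padicValNat p j) := by positivity
  rw [inv_mul_eq_div, le_div_iff₀ this]; linarith

lemma choose_norm (k j : ℕ) (hj : j ≠ 0) : ‖(k.choose j : ℚ_[p])‖ ≤ ‖(k : ℚ_[p])‖ * j := by
  obtain ⟨i, rfl⟩ := Nat.exists_eq_succ_of_ne_zero hj
  rcases k with _ | k
  · simp
  have h := Nat.add_one_mul_choose_eq k i
  have h' : ((k + 1 : ℕ) : ℚ_[p]) * (k.choose i : ℚ_[p]) = ((k+1).choose (i+1) : ℚ_[p]) * ((i + 1 : ℕ) : ℚ_[p]) := by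
    exact_mod_cast h
  have h2 := congrArg norm h'
  rw [norm_mul, norm_mul] at h2
  have h3 : ‖(k.choose i : ℚ_[p])‖ ≤ 1 := by simpa using Padic.norm_int_le_one (p := p) (k.choose i : ℤ)
  have h4 := norm_nat_ge (p := p) (j := i + 1) (by omega)
  have h5 := norm_nonneg ((k + 1 : ℕ) : ℚ_[p])
  have h6 := norm_nonneg ((k+1).choose (i+1) : ℚ_[p])
  calc ‖((k+1).choose (i+1) : ℚ_[p])‖ ≤ ‖((k+1).choose (i+1) : ℚ_[p])‖ * (‖((i+1 : ℕ) : ℚ_[p])‖ * ((i+1 : ℕ):ℝ)) := by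
        exact le_mul_of_one_le_right h6 h4
    _ = (‖((k + 1 : ℕ) : ℚ_[p])‖ * ‖(k.choose i : ℚ_[p])‖) * ((i+1 : ℕ):ℝ) := by rw [h2]; ring
    _ ≤ _ := by
      apply mul_le_mul_of_nonneg_right _ (by positivity)
      exact mul_le_of_le_one_right h5 h3

lemma expand (k m : ℕ) (hm : 1 ≤ m) (u : ℚ_[p]) :
    (1 + u) ^ k = ∑ j ∈ range m, (k.choose j : ℚ_[p]) * u ^ j
      + ∑ i ∈ range k, (k.choose (m + i) : ℚ_[p]) * u ^ (m + i) := by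
  rw [← Finset.sum_range_add (fun j => (k.choose j : ℚ_[p]) * u ^ j), add_comm 1 u, add_pow]
  simp only [one_pow, mul_one]
  rw [← Finset.sum_subset (s₁ := range (k+1)) (s₂ := range (m + k))]
  · exact Finset.sum_congr rfl fun _ _ => mul_comm _ _
  · exact Finset.range_subset_range.2 (by omega)
  · intro j _ hj
    rw [Nat.choose_eq_zero_of_lt (by simpa using hj)]; simp

lemma sum_lt (s : Finset ℕ) (f : ℕ → ℚ_[p]) {c : ℝ} (hc : 0 < c) (h : ∀ i ∈ s, ‖f i‖ < c) :
    ‖∑ i ∈ s, f i‖ < c := by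
  induction s using Finset.induction_on with
  | empty => simpa
  | insert a s ha ih =>
    rw [Finset.sum_insert ha]
    exact add_lt (h a (by simp)) (ih fun i hi => h i (by simp [hi]))

/-- tail of the binomial expansion -/
lemma tail (hp : 3 ≤ p) (k m l : ℕ) (hk : 1 ≤ k) (hm : 1 ≤ m) (hml : m < 3 ^ (m - l))
    (hlm : l < m) {u : ℚ_[p]} (hu : ‖u‖ < 1) (hu0 : u ≠ 0) :
    ‖∑ i ∈ range k, (k.choose (m + i) : ℚ_[p]) * u ^ (m + i)‖ < ‖(k : ℚ_[p])‖ * ‖u‖ ^ l := by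
  have hK : 0 < ‖(k : ℚ_[p])‖ := norm_pos_iff.2 (by exact_mod_cast (by omega : k ≠ 0))
  have hU : 0 < ‖u‖ := norm_pos_iff.2 hu0
  apply sum_lt _ _ (by positivity)
  intro i hi
  clear hi
  have h1 := choose_norm (p := p) k (m + i) (by omega)
  rw [norm_mul, norm_pow]
  have h3 : m + i < 3 ^ (m - l + i) := by
    clear h1
    induction i with
    | zero => simpa
    | succ i ih =>
      rw [← add_assoc, ← add_assoc, pow_succ]; omega
  have h4 : ((m + i : ℕ) : ℝ) < 3 ^ (m - l + i) := by exact_mod_cast h3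
  have h5 : ‖u‖ ^ (m - l + i) ≤ (1/3) ^ (m - l + i) := pow_le_pow_left₀ hU.le (norm_third hp hu) _
  have h6 : ((m + i : ℕ) : ℝ) * ‖u‖ ^ (m - l + i) < 1 := by
    calc ((m + i : ℕ) : ℝ) * ‖u‖ ^ (m - l + i) < 3 ^ (m - l + i) * ‖u‖ ^ (m - l + i) := by
          apply mul_lt_mul_of_pos_right h4 (by positivity)
      _ ≤ 3 ^ (m - l + i) * (1/3) ^ (m - l + i) := by gcongr
      _ = 1 := by rw [← mul_pow]; norm_num
  calc _ ≤ (‖(k : ℚ_[p])‖ * ((m + i : ℕ) : ℝ)) * ‖u‖ ^ (m + i) := by gcongr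
    _ = (‖(k : ℚ_[p])‖ * ‖u‖ ^ l) * (((m + i : ℕ) : ℝ) * ‖u‖ ^ (m - l + i)) := by
      have : m + i = l + (m - l + i) := by omega
      nth_rw 2 [this]; rw [pow_add]; ring
    _ < _ := mul_lt_of_lt_one_right (by positivity) h6

lemma pow_sub_one (hp : 3 ≤ p) {k : ℕ} (hk : 1 ≤ k) {u : ℚ_[p]} (hu : ‖u‖ < 1) :
    ‖(1 + u) ^ k - 1‖ = ‖(k : ℚ_[p])‖ * ‖u‖ := by
  by_cases hu0 : u = 0
  · simp [hu0]
  have h := tail hp k 2 1 hk (by norm_num) (by norm_num) (by norm_num) hu hu0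
  have e := expand k 2 (by norm_num) u
  simp only [Finset.sum_range_succ, Finset.sum_range_zero] at e
  rw [e, ← norm_mul, ← add_eq (a := (k : ℚ_[p]) * u) (by simpa using h)]
  congr 1
  simp
  ring

lemma norm_one_add {u : ℚ_[p]} (hu : ‖u‖ < 1) : ‖1 + u‖ = 1 := by
  rw [add_eq (by simpa)]; simp

lemma pow_sub_pow (hp : 3 ≤ p) {k : ℕ} (hk : 1 ≤ k) {u v : ℚ_[p]} (hu : ‖u‖ < 1) (hv : ‖v‖ < 1) :
    ‖(1 + u) ^ k - (1 + v) ^ k‖ = ‖(k : ℚ_[p])‖ * ‖u - v‖ := by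
  have hn := norm_one_add hv
  have h0 : 1 + v ≠ 0 := by intro h; simp [h] at hn
  have hw : ‖(u - v) / (1 + v)‖ = ‖u - v‖ := by rw [norm_div, hn, div_one]
  have := pow_sub_one hp hk (u := (u - v) / (1 + v)) (by rw [hw]; exact sub_lt hu hv)
  rw [hw] at this
  have e : (1 + u) ^ k - (1 + v) ^ k = ((1 + (u - v) / (1 + v)) ^ k - 1) * (1 + v) ^ k := by
    rw [sub_mul, ← mul_pow, one_mul]
    congr 2
    field_simp; ring
  rw [← this, e, norm_mul, norm_pow, hn, one_pow, mul_one]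

lemma cubic (hp : 3 ≤ p) {k : ℕ} (hk : 1 ≤ k) {s a b D : ℚ_[p]} (hs : ‖s‖ < 1) (hs0 : s ≠ 0)
    (ha : a = ((k : ℚ_[p]) - 1) / 2) (hb : b = ((k : ℚ_[p]) - 1) * ((k : ℚ_[p]) - 2) / 6)
    (hD : D = 1 - a * s + b * s ^ 2) :
    ‖D‖ = 1 ∧ ‖(1 + -s / D) ^ k - 1 + k * s‖ < ‖(k : ℚ_[p])‖ * ‖s‖ ^ 2 := by
  have hK : 0 < ‖(k : ℚ_[p])‖ := norm_pos_iff.2 (by exact_mod_cast (by omega : k ≠ 0))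
  have hS : 0 < ‖s‖ := norm_pos_iff.2 hs0
  have h3 := norm_third hp hs
  have n2 : ‖(2 : ℚ_[p])‖ = 1 := by
    have := (Padic.norm_natCast_eq_one_iff (p := p) (n := 2)).2 ((Nat.coprime_primes Fact.out Nat.prime_two).2 (by omega))
    simpa using this
  have n3 : 1 / 3 ≤ ‖(3 : ℚ_[p])‖ := by
    have := norm_nat_ge (p := p) (j := 3) (by norm_num)
    push_cast at this; linarith
  have n6 : 1 / 3 ≤ ‖(6 : ℚ_[p])‖ := by
    rw [show (6 : ℚ_[p]) = 2 * 3 by norm_num, norm_mul, n2, one_mul]; exact n3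
  have nk1 : ‖(k : ℚ_[p]) - 1‖ ≤ 1 := by simpa using Padic.norm_int_le_one (p := p) ((k : ℤ) - 1)
  have nk2 : ‖(k : ℚ_[p]) - 2‖ ≤ 1 := by simpa using Padic.norm_int_le_one (p := p) ((k : ℤ) - 2)
  have na : ‖a‖ ≤ 1 := by rw [ha, norm_div, n2, div_one]; exact nk1
  have nbs : ‖b * s‖ ≤ 1 := by
    rw [hb, norm_mul, norm_div, norm_mul, div_mul_eq_mul_div, div_le_one (by linarith)]
    calc _ ≤ 1 * 1 * ‖s‖ := by gcongr
      _ ≤ _ := by linarith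
  have nle : ∀ x y : ℚ_[p], ‖x‖ ≤ 1 → ‖y‖ ≤ 1 → ‖x + y‖ ≤ 1 := fun x y hx hy =>
    (Padic.nonarchimedean x y).trans (max_le hx hy)
  have nsub : ∀ x y : ℚ_[p], ‖x‖ ≤ 1 → ‖y‖ ≤ 1 → ‖x - y‖ ≤ 1 := fun x y hx hy => by
    rw [sub_eq_add_neg]; exact nle _ _ hx (by rwa [norm_neg])
  have nmul : ∀ x y : ℚ_[p], ‖x‖ ≤ 1 → ‖y‖ ≤ 1 → ‖x * y‖ ≤ 1 := fun x y hx hy => by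
    rw [norm_mul]; exact mul_le_one₀ hx (norm_nonneg _) hy
  have nc := nsub a (b * s) na nbs
  have nD : ‖D‖ = 1 := by
    rw [hD, show 1 - a * s + b * s ^ 2 = 1 + -(s * (a - b * s)) by ring]
    apply norm_one_add
    rw [norm_neg, norm_mul]
    exact lt_of_le_of_lt (mul_le_of_le_one_right (norm_nonneg _) nc) hs
  have hD0 : D ≠ 0 := by intro h; simp [h] at nD
  refine ⟨nD, ?_⟩
  have nu : ‖-s / D‖ = ‖s‖ := by rw [norm_div, nD, norm_neg, div_one]
  have ht := tail hp k 4 2 hk (by norm_num) (by norm_num) (by norm_num)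
    (u := -s / D) (by rw [nu]; exact hs) (by rw [← norm_pos_iff, nu]; exact hS)
  rw [nu] at ht
  have e := expand k 4 (by norm_num) (-s / D)
  simp only [Finset.sum_range_succ, Finset.sum_range_zero] at e
  have c2 : (k.choose 2 : ℚ_[p]) = k * a := by
    rw [Nat.cast_choose_two, ha]; ring
  have c3 : (k.choose 3 : ℚ_[p]) = k * b := by
    have h1 := Nat.add_one_mul_choose_eq (k - 1) 2
    have h2 : k - 1 + 1 = k := by omega
    rw [h2] at h1
    have h4 : (k : ℚ_[p]) * ((k - 1 : ℕ).choose 2 : ℚ_[p]) = (k.choose 3 : ℚ_[p]) * 3 := by exact_mod_cast h1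
    rw [Nat.cast_choose_two, Nat.cast_sub hk] at h4
    rw [hb]
    linear_combination -h4 / 3
  have key : (1 + -s / D) ^ k - 1 + k * s = k * (s ^ 3 * ((a - b * s) * (a * D - b * s * (1 + D))) / D ^ 3)
      + ∑ i ∈ range k, (k.choose (4 + i) : ℚ_[p]) * (-s / D) ^ (4 + i) := by
    rw [e, c2, c3]
    simp only [Nat.choose_zero_right, Nat.choose_one_right]
    rw [← sub_eq_zero]
    have : (-s/D) + a * (-s/D)^2 + b * (-s/D)^3 + s = s ^ 3 * ((a - b * s) * (a * D - b * s * (1 + D))) / D ^ 3 := by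
      field_simp
      rw [hD]; ring
    rw [← this]; push_cast; ring
  rw [key]
  refine add_lt ?_ ht
  rw [norm_mul]
  apply mul_lt_mul_of_pos_left _ hK
  rw [norm_div, norm_pow, nD, one_pow, div_one, norm_mul, norm_pow]
  have : ‖(a - b * s) * (a * D - b * s * (1 + D))‖ ≤ 1 :=
    nmul _ _ nc (nsub _ _ (nmul _ _ na nD.le) (nmul _ _ nbs (nle _ _ (by simp) nD.le)))
  calc _ ≤ ‖s‖ ^ 3 * 1 := by gcongr
    _ < ‖s‖ ^ 2 := by nlinarith [pow_pos hS 2]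

lemma hensel_root {k : ℕ} (hk : 1 ≤ k) {g : ℚ_[p]} (hg : ‖g‖ ≤ 1) (h : ‖g ^ k - 1‖ < 1) :
    ∃ ξ : ℚ_[p], ξ ^ k = 1 ∧ ‖ξ - g‖ < 1 := by
  obtain ⟨m, l, hl, rfl⟩ := Nat.exists_eq_pow_mul_and_not_dvd (n := k) (by omega) p (Fact.out : p.Prime).ne_one
  obtain ⟨g, rfl⟩ : ∃ g' : ℤ_[p], (g' : ℚ_[p]) = g := ⟨⟨g, hg⟩, rfl⟩
  have key : ∀ z : ℤ_[p], ‖z‖ < 1 ↔ PadicInt.toZMod z = 0 := by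
    intro z
    rw [← RingHom.mem_ker, PadicInt.ker_toZMod, IsLocalRing.mem_maximalIdeal, PadicInt.mem_nonunits]
  have h1 : ‖g ^ (p ^ m * l) - 1‖ < 1 := by
    rw [← PadicInt.padic_norm_e_of_padicInt]; push_cast; exact h
  have h2 : ‖g ^ l - 1‖ < 1 := by
    rw [key] at h1 ⊢
    simp only [map_sub, map_pow, map_one] at h1 ⊢
    rwa [mul_comm, pow_mul, ZMod.pow_card_pow] at h1
  have hgl : ‖g ^ l‖ = 1 := by
    by_contra hne
    have h3 : ‖g ^ l‖ < 1 := lt_of_le_of_ne (PadicInt.norm_le_one _) hne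
    rw [key] at h2 h3
    rw [map_sub, h3] at h2
    simp at h2
  have hl0 : l ≠ 0 := by rintro rfl; simp at hl
  have hg1 : ‖g‖ = 1 := by
    rw [norm_pow] at hgl
    exact (pow_eq_one_iff_of_nonneg (norm_nonneg _) hl0).1 hgl
  have hln : ‖(l : ℤ_[p])‖ = 1 := by
    rw [PadicInt.norm_natCast_eq_one_iff]
    exact (Nat.Prime.coprime_iff_not_dvd Fact.out).2 hl
  have hder : ‖(Polynomial.X ^ l - 1 : Polynomial ℤ_[p]).derivative.aeval g‖ = 1 := by
    simp [Polynomial.derivative_X_pow, hg1, hln]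
  obtain ⟨z, hz, hz2, -⟩ := hensels_lemma (F := (Polynomial.X ^ l - 1 : Polynomial ℤ_[p])) (a := g)
    (by rw [hder]; simpa using h2)
  rw [hder] at hz2
  refine ⟨z, ?_, ?_⟩
  · have : z ^ l = 1 := by simpa [sub_eq_zero] using hz
    rw [mul_comm, pow_mul]
    have h5 : (z : ℚ_[p]) ^ l = 1 := by exact_mod_cast congrArg (fun z : ℤ_[p] => (z : ℚ_[p])) this
    rw [h5, one_pow]
  · rw [← PadicInt.padic_norm_e_of_padicInt] at hz2; push_cast at hz2; exact hz2


lemma nat_le_one (k : ℕ) : ‖(k : ℚ_[p])‖ ≤ 1 := by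
  simpa using Padic.norm_int_le_one (p := p) (k : ℤ)

lemma norm_corr {q : ℕ} {t y : ℚ_[p]} (hq0 : ‖(q : ℚ_[p])‖ < 1) (ht : ‖t‖ < ‖(q : ℚ_[p])‖ ^ 2) :
    ‖t * (q + t) / y‖ = ‖t‖ * ‖(q : ℚ_[p])‖ / ‖y‖ := by
  rw [norm_div, norm_mul, add_eq]
  nlinarith [norm_nonneg (q : ℚ_[p])]

lemma step1 (hp : 3 ≤ p) {q k : ℕ} (hk : 1 ≤ k) (hq0 : 0 < ‖(q : ℚ_[p])‖) {t y : ℚ_[p]}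
    (hqk : ‖(q : ℚ_[p])‖ < ‖(k : ℚ_[p])‖) (ht : ‖t‖ < ‖(q : ℚ_[p])‖ ^ 2)
    (hy : ‖(k : ℚ_[p]) * t‖ < ‖y‖) :
    ‖(1 + (t - t * (q + t) / y)) ^ k - 1‖ < ‖(q : ℚ_[p])‖ := by
  have hk1 := nat_le_one (p := p) k
  have hq1 := hqk.trans_le hk1
  have hy0 : 0 < ‖y‖ := (norm_nonneg _).trans_lt hy
  have htq : ‖t‖ < ‖(q : ℚ_[p])‖ := by nlinarith
  rw [norm_mul] at hy
  have ht0 := norm_nonneg t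
  have hK := hq0.trans hqk
  have hc := norm_corr (y := y) hq1 ht
  have h1 : ‖t * (q + t) / y‖ < ‖(q : ℚ_[p])‖ / ‖(k : ℚ_[p])‖ := by
    rw [hc, div_lt_div_iff₀ hy0 hK]; nlinarith
  have h2 : ‖t - t * (q + t) / y‖ < ‖(q : ℚ_[p])‖ / ‖(k : ℚ_[p])‖ := by
    refine sub_lt ?_ h1
    rw [lt_div_iff₀ hK]; nlinarith
  rw [pow_sub_one hp hk (h2.trans ((div_lt_one hK).2 hqk))]
  rw [lt_div_iff₀ hK] at h2; linarith

lemma caseA (hp : 3 ≤ p) {q k : ℕ} (hk : 1 ≤ k) (hq0 : 0 < ‖(q : ℚ_[p])‖) {t y : ℚ_[p]}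
    (hqk : ‖(q : ℚ_[p])‖ < ‖(k : ℚ_[p])‖) (ht : ‖t‖ < ‖(q : ℚ_[p])‖ ^ 2)
    (hy : ‖y‖ < ‖(k : ℚ_[p]) * t‖) (hy' : ‖(q : ℚ_[p]) * t‖ < ‖y‖) :
    ‖(k : ℚ_[p]) * t‖ < ‖(1 + (t - t * (q + t) / y)) ^ k - 1 + (q + t)‖ := by
  have hk1 := nat_le_one (p := p) k
  have hq1 := hqk.trans_le hk1
  have hy0 : 0 < ‖y‖ := (norm_nonneg _).trans_lt hy'
  have htq : ‖t‖ < ‖(q : ℚ_[p])‖ := by nlinarith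
  rw [norm_mul] at hy hy' ⊢
  have ht0 := norm_nonneg t
  have hK := hq0.trans hqk
  have hc := norm_corr (y := y) hq1 ht
  have h1 : ‖t‖ < ‖t * (q + t) / y‖ := by
    rw [hc, lt_div_iff₀ hy0]
    have : 0 < ‖t‖ := by by_contra h; nlinarith
    apply mul_lt_mul_of_pos_left _ this
    nlinarith
  have h2 : ‖t - t * (q + t) / y‖ = ‖t‖ * ‖(q : ℚ_[p])‖ / ‖y‖ := by
    rw [← hc, norm_sub_rev, sub_eq_add_neg, add_eq (by rwa [norm_neg])]
  have h3 : ‖(1 + (t - t * (q + t) / y)) ^ k - 1‖ = ‖(k : ℚ_[p])‖ * (‖t‖ * ‖(q : ℚ_[p])‖ / ‖y‖) := by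
    rw [pow_sub_one hp hk, h2]
    rw [h2, div_lt_one hy0]; linarith
  have h4 : ‖(q : ℚ_[p])‖ < ‖(k : ℚ_[p])‖ * (‖t‖ * ‖(q : ℚ_[p])‖ / ‖y‖) := by
    rw [← mul_div_assoc, lt_div_iff₀ hy0]; nlinarith
  rw [add_eq, h3]
  · nlinarith
  · rw [h3]
    exact add_lt h4 (htq.trans h4)

lemma caseD {q k : ℕ} (hk : 1 ≤ k) (hq0 : 0 < ‖(q : ℚ_[p])‖) {t y : ℚ_[p]}
    (hqk : ‖(q : ℚ_[p])‖ < ‖(k : ℚ_[p])‖) (ht : ‖t‖ < ‖(q : ℚ_[p])‖ ^ 2)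
    (hy0 : 0 < ‖y‖) (hy : ‖y‖ < ‖(q : ℚ_[p]) * t‖) :
    ‖(k : ℚ_[p]) * t‖ < ‖(1 + (t - t * (q + t) / y)) ^ k - 1 + (q + t)‖ := by
  have hk1 := nat_le_one (p := p) k
  have hq1 := hqk.trans_le hk1
  have htq : ‖t‖ < ‖(q : ℚ_[p])‖ := by nlinarith
  rw [norm_mul] at hy ⊢
  have ht0 := norm_nonneg t
  have hc := norm_corr (y := y) hq1 ht
  have h1 : 1 < ‖t * (q + t) / y‖ := by
    rw [hc, lt_div_iff₀ hy0]; linarith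
  have h1t : ‖1 + t‖ = 1 := norm_one_add (htq.trans hq1)
  have h2 : 1 < ‖1 + (t - t * (q + t) / y)‖ := by
    rw [show 1 + (t - t * (q + t) / y) = -(t * (q + t) / y) + (1 + t) by ring, add_eq]
    · rwa [norm_neg]
    · rw [norm_neg, h1t]; exact h1
  have h3 : 1 < ‖(1 + (t - t * (q + t) / y)) ^ k‖ := by
    rw [norm_pow]; exact one_lt_pow₀ h2 (by omega)
  have h4 : ‖-1 + ((q : ℚ_[p]) + t)‖ = 1 := by
    rw [add_eq]
    · simp
    · simpa using add_lt hq1 (htq.trans hq1)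
  rw [show (1 + (t - t * (q + t) / y)) ^ k - 1 + (q + t) = (1 + (t - t * (q + t) / y)) ^ k + (-1 + ((q : ℚ_[p]) + t)) by ring,
    add_eq (by rwa [h4])]
  nlinarith

lemma caseB (hp : 3 ≤ p) {q k : ℕ} (hk : 1 ≤ k) (hq0 : 0 < ‖(q : ℚ_[p])‖) {t y : ℚ_[p]}
    (hqk : ‖(q : ℚ_[p])‖ < ‖(k : ℚ_[p])‖) (ht : ‖t‖ < ‖(q : ℚ_[p])‖ ^ 2)
    (hy : ‖y‖ = ‖(k : ℚ_[p]) * t‖) (ht0 : 0 < ‖t‖)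
    (hX : ‖(q : ℚ_[p]) * t‖ ≤ ‖y - t * (k * (1 - ((k : ℚ_[p]) - 1) / 2 * (q / k)
      + ((k : ℚ_[p]) - 1) * ((k : ℚ_[p]) - 2) / 6 * (q / k : ℚ_[p]) ^ 2))‖) :
    ‖(k : ℚ_[p]) * t‖ < ‖(1 + (t - t * (q + t) / y)) ^ k - 1 + (q + t)‖ := by
  have hk1 := nat_le_one (p := p) k
  have hq1 := hqk.trans_le hk1
  have hK := hq0.trans hqk
  have hk0 : (k : ℚ_[p]) ≠ 0 := norm_pos_iff.1 hK
  have htn : t ≠ 0 := norm_pos_iff.1 ht0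
  have hqn : (q : ℚ_[p]) ≠ 0 := norm_pos_iff.1 hq0
  have htq : ‖t‖ < ‖(q : ℚ_[p])‖ := by nlinarith
  rw [norm_mul] at hy hX ⊢
  have hy0 : 0 < ‖y‖ := by rw [hy]; positivity
  have hyn : y ≠ 0 := norm_pos_iff.1 hy0
  have hc := norm_corr (y := y) hq1 ht
  set s : ℚ_[p] := q / k with hs
  have ns : ‖s‖ = ‖(q : ℚ_[p])‖ / ‖(k : ℚ_[p])‖ := norm_div _ _
  have ns1 : ‖s‖ < 1 := by rw [ns, div_lt_one hK]; exact hqk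
  have ns0 : 0 < ‖s‖ := by rw [ns]; positivity
  have hqs : ‖(q : ℚ_[p])‖ = ‖(k : ℚ_[p])‖ * ‖s‖ := by rw [ns]; field_simp
  obtain ⟨nD, hcub⟩ := cubic hp hk ns1 (norm_pos_iff.1 ns0) rfl rfl rfl
  set D : ℚ_[p] := 1 - ((k : ℚ_[p]) - 1) / 2 * s
      + ((k : ℚ_[p]) - 1) * ((k : ℚ_[p]) - 2) / 6 * s ^ 2 with hD
  have hD0 : D ≠ 0 := by intro h; simp [h] at nD
  have hqq : ‖(q : ℚ_[p])‖ ^ 2 ≤ ‖(k : ℚ_[p])‖ * ‖s‖ ^ 2 := by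
    rw [hqs]
    have : 0 < ‖s‖ ^ 2 := by positivity
    nlinarith [mul_pos hK this]
  have h1 : ‖t * (q + t) / y‖ = ‖s‖ := by
    rw [hc, hy, ns]; field_simp
  have hu : ‖t - t * (q + t) / y‖ < 1 := sub_lt (by linarith) (by rwa [h1])
  have hv : ‖-s / D‖ < 1 := by rw [norm_div, nD, norm_neg, div_one]; exact ns1
  have e : (t - t * (q + t) / y) - (-s / D) = s * (y - t * (k * D)) / (D * y) + (t - t ^ 2 / y) := by
    rw [hs]; field_simp; ring
  have n1 : ‖s‖ ^ 2 ≤ ‖s * (y - t * (k * D)) / (D * y)‖ := by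
    rw [norm_div (s * _), norm_mul s, norm_mul D, nD, one_mul, le_div_iff₀ hy0, hy]
    calc ‖s‖ ^ 2 * (‖(k : ℚ_[p])‖ * ‖t‖) = ‖s‖ * (‖(q : ℚ_[p])‖ * ‖t‖) := by rw [hqs]; ring
      _ ≤ _ := by gcongr
  have hts : ‖t‖ < ‖(k : ℚ_[p])‖ * ‖s‖ ^ 2 := by linarith
  have n2 : ‖t - t ^ 2 / y‖ < ‖s‖ ^ 2 := by
    refine sub_lt ?_ ?_
    · nlinarith [pow_pos ns0 2]
    · rw [norm_div, norm_pow, hy, div_lt_iff₀ (by positivity)]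
      nlinarith
  have n3 : ‖s‖ ^ 2 ≤ ‖(t - t * (q + t) / y) - (-s / D)‖ := by
    rw [e, add_eq (by linarith)]; exact n1
  have n4 : ‖(k : ℚ_[p])‖ * ‖s‖ ^ 2 ≤ ‖(1 + (t - t * (q + t) / y)) ^ k - (1 + -s / D) ^ k‖ := by
    rw [pow_sub_pow hp hk hu hv]; gcongr
  have e2 : (1 + (t - t * (q + t) / y)) ^ k - 1 + (q + t) =
      ((1 + (t - t * (q + t) / y)) ^ k - (1 + -s / D) ^ k) + (((1 + -s / D) ^ k - 1 + k * s) + t) := by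
    have : (k : ℚ_[p]) * s = q := by rw [hs]; field_simp
    rw [this]; ring
  rw [e2, add_eq ((add_lt hcub hts).trans_le n4)]
  refine lt_of_lt_of_le ?_ n4
  nlinarith

lemma caseC {q k : ℕ} (hk : 1 ≤ k) (hq0 : 0 < ‖(q : ℚ_[p])‖) {t y : ℚ_[p]}
    (hqk : ‖(q : ℚ_[p])‖ < ‖(k : ℚ_[p])‖) (ht : ‖t‖ < ‖(q : ℚ_[p])‖ ^ 2)
    (hy : ‖y‖ = ‖(q : ℚ_[p]) * t‖) (ht0 : 0 < ‖t‖)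
    (hX : ∀ ξ : ℚ_[p], ξ ^ k = 1 → ξ ≠ 1 → ‖(q : ℚ_[p]) * t‖ ≤ ‖y - q * t / (1 - ξ)‖) :
    ‖(k : ℚ_[p]) * t‖ < ‖(1 + (t - t * (q + t) / y)) ^ k - 1 + (q + t)‖ := by
  have hk1 := nat_le_one (p := p) k
  have hq1 := hqk.trans_le hk1
  have htq : ‖t‖ < ‖(q : ℚ_[p])‖ := by nlinarith
  have htn : t ≠ 0 := norm_pos_iff.1 ht0
  have hqn : (q : ℚ_[p]) ≠ 0 := norm_pos_iff.1 hq0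
  have hy0 : 0 < ‖y‖ := by rw [hy, norm_mul]; positivity
  have hyn : y ≠ 0 := norm_pos_iff.1 hy0
  have hc := norm_corr (y := y) hq1 ht
  rw [hy, norm_mul, mul_comm ‖(q : ℚ_[p])‖, div_self (by positivity)] at hc
  set u : ℚ_[p] := t - t * (q + t) / y with hu
  have nu : ‖u‖ = 1 := by
    rw [hu, norm_sub_rev, sub_eq_add_neg, add_eq, hc]
    rw [norm_neg, hc]; linarith
  have ng : ‖1 + u‖ ≤ 1 := (Padic.nonarchimedean _ _).trans (by simp [nu])
  have hbig : ‖(q : ℚ_[p])‖ < ‖(1 + u) ^ k - 1‖ := by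
    by_contra hcon
    push Not at hcon
    obtain ⟨ξ, hξ, hξg⟩ := hensel_root hk ng (hcon.trans_lt hq1)
    have n1 : ‖1 - ξ‖ = 1 := by
      rw [show 1 - ξ = -u + -(ξ - (1 + u)) by ring, add_eq, norm_neg, nu]
      rw [norm_neg, norm_neg, nu]; exact hξg
    have hξ0 : 1 - ξ ≠ 0 := by intro h; simp [h] at n1
    have hξ1 : ξ ≠ 1 := by rintro rfl; simp at hξ0
    have h := hX ξ hξ hξ1
    have e : y - q * t / (1 - ξ) = y / (1 - ξ) * (-(ξ - (1 + u)) - (t - t ^ 2 / y)) := by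
      rw [hu]; field_simp; ring
    have n2 : ‖t ^ 2 / y‖ < 1 := by
      rw [norm_div, norm_pow, hy, norm_mul, div_lt_one (by positivity)]; nlinarith
    have n3 : ‖-(ξ - (1 + u)) - (t - t ^ 2 / y)‖ < 1 :=
      sub_lt (by rwa [norm_neg]) (sub_lt (by linarith) n2)
    rw [e, norm_mul (y / _), norm_div, n1, div_one, ← hy] at h
    nlinarith
  rw [add_eq (add_lt hbig (htq.trans hbig))]
  rw [norm_mul]; nlinarith

lemma pb_eq (q k : ℕ) (θ x : ℚ_[p]) (hx : x ≠ 2 - (q : ℚ_[p]) - θ) :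
    pottsBethe p q k θ x =
      (1 + ((θ - 1) - (θ - 1) * (q + (θ - 1)) / (x - (2 - (q : ℚ_[p]) - θ)))) ^ k := by
  have h1 : x - (2 - (q : ℚ_[p]) - θ) ≠ 0 := sub_ne_zero.2 hx
  have h2 : x + θ + (q : ℚ_[p]) - 2 = x - (2 - (q : ℚ_[p]) - θ) := by ring
  unfold pottsBethe
  rw [h2]
  congr 1
  rw [div_eq_iff h1]
  have : (1 + ((θ - 1) - (θ - 1) * (q + (θ - 1)) / (x - (2 - (q : ℚ_[p]) - θ))))
      * (x - (2 - (q : ℚ_[p]) - θ)) = θ * (x - (2 - (q : ℚ_[p]) - θ)) - (θ - 1) * (q + (θ - 1))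
      / (x - (2 - (q : ℚ_[p]) - θ)) * (x - (2 - (q : ℚ_[p]) - θ)) := by ring
  rw [this, div_mul_cancel₀ _ h1]; ring

/-- Far from the pole: one step leads to the basin. -/
lemma far_step (hp : 3 ≤ p) {q k : ℕ} (hk : 1 ≤ k) (hq0 : 0 < ‖(q : ℚ_[p])‖) {θ x : ℚ_[p]}
    (hqk : ‖(q : ℚ_[p])‖ < ‖(k : ℚ_[p])‖) (ht : ‖θ - 1‖ < ‖(q : ℚ_[p])‖ ^ 2)
    (hy : ‖(k : ℚ_[p]) * (θ - 1)‖ < ‖x - (2 - (q : ℚ_[p]) - θ)‖) :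
    ‖pottsBethe p q k θ x - 1‖ < ‖(q : ℚ_[p])‖ := by
  rw [pb_eq]
  · exact step1 hp hk hq0 hqk ht hy
  · rintro rfl
    rw [sub_self, norm_zero] at hy
    exact absurd hy (not_lt.2 (norm_nonneg _))

lemma first_step (hp : 3 ≤ p) {q k : ℕ} (hk : 1 ≤ k) (hq0 : 0 < ‖(q : ℚ_[p])‖) {θ x : ℚ_[p]}
    (hqk : ‖(q : ℚ_[p])‖ < ‖(k : ℚ_[p])‖) (ht : ‖θ - 1‖ < ‖(q : ℚ_[p])‖ ^ 2)
    (hx : x ≠ 2 - (q : ℚ_[p]) - θ) (hxX : x ∉ XSet p q k θ)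
    (hy : ‖x - (2 - (q : ℚ_[p]) - θ)‖ ≤ ‖(k : ℚ_[p]) * (θ - 1)‖) :
    ‖(k : ℚ_[p]) * (θ - 1)‖ < ‖pottsBethe p q k θ x - (2 - (q : ℚ_[p]) - θ)‖ := by
  have hy0 : 0 < ‖x - (2 - (q : ℚ_[p]) - θ)‖ := norm_pos_iff.2 (sub_ne_zero.2 hx)
  have ht0 : 0 < ‖θ - 1‖ := by
    rw [norm_pos_iff]; intro h
    rw [h, mul_zero, norm_zero] at hy; linarith
  have hk0 : (k : ℚ_[p]) ≠ 0 := norm_pos_iff.1 (hq0.trans hqk)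
  have hX : ∀ ξ : ℚ_[p], ξ ^ k = 1 → ‖(q : ℚ_[p]) * (θ - 1)‖ ≤ ‖x - xiCenter p q k θ ξ‖ := by
    intro ξ hξ
    by_contra h
    exact hxX ⟨ξ, hξ, not_le.1 h⟩
  rw [pb_eq q k θ x hx]
  have e : ∀ z : ℚ_[p], z - (2 - (q : ℚ_[p]) - θ) = z - 1 + (q + (θ - 1)) := fun z => by ring
  rw [e (_ ^ k)]
  rcases hy.eq_or_lt with h1 | h1
  · apply caseB hp hk hq0 hqk ht h1 ht0
    refine (hX 1 (one_pow _)).trans (le_of_eq ?_)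
    congr 1
    rw [xiCenter, if_pos rfl]
    field_simp; ring
  rcases lt_trichotomy ‖x - (2 - (q : ℚ_[p]) - θ)‖ ‖(q : ℚ_[p]) * (θ - 1)‖ with h2 | h2 | h2
  · exact caseD hk hq0 hqk ht hy0 h2
  · apply caseC hk hq0 hqk ht h2 ht0
    intro ξ hξ hξ1
    refine (hX ξ hξ).trans (le_of_eq ?_)
    congr 1
    rw [xiCenter, if_neg hξ1]; ring
  · exact caseA hp hk hq0 hqk ht h1 h2

lemma basin_ne {q : ℕ} {θ x : ℚ_[p]} (hq1 : ‖(q : ℚ_[p])‖ < 1)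
    (ht : ‖θ - 1‖ < ‖(q : ℚ_[p])‖ ^ 2) (hx : ‖x - 1‖ < ‖(q : ℚ_[p])‖) :
    ‖x - (2 - (q : ℚ_[p]) - θ)‖ = ‖(q : ℚ_[p])‖ := by
  rw [show x - (2 - (q : ℚ_[p]) - θ) = q + ((x - 1) + (θ - 1)) by ring, add_eq]
  exact add_lt hx (by nlinarith [norm_nonneg (q : ℚ_[p])])

lemma basin_step (hp : 3 ≤ p) {q k : ℕ} (hk : 1 ≤ k) (hq0 : 0 < ‖(q : ℚ_[p])‖) {θ x : ℚ_[p]}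
    (hqk : ‖(q : ℚ_[p])‖ < ‖(k : ℚ_[p])‖) (ht : ‖θ - 1‖ < ‖(q : ℚ_[p])‖ ^ 2)
    (hx : ‖x - 1‖ < ‖(q : ℚ_[p])‖) :
    ‖pottsBethe p q k θ x - 1‖ ≤ ‖(q : ℚ_[p])‖ * ‖x - 1‖ := by
  have hk1 := nat_le_one (p := p) k
  have hq1 := hqk.trans_le hk1
  have hn := basin_ne hq1 ht hx
  have hy0 : x - (2 - (q : ℚ_[p]) - θ) ≠ 0 := by rw [← norm_pos_iff, hn]; exact hq0
  rw [pb_eq q k θ x (sub_ne_zero.1 hy0)]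
  have e : (θ - 1) - (θ - 1) * (q + (θ - 1)) / (x - (2 - (q : ℚ_[p]) - θ))
      = (θ - 1) * (x - 1) / (x - (2 - (q : ℚ_[p]) - θ)) := by
    rw [eq_div_iff hy0, sub_mul, div_mul_cancel₀ _ hy0]; ring
  have hle : ‖(θ - 1) * (x - 1) / (x - (2 - (q : ℚ_[p]) - θ))‖ ≤ ‖(q : ℚ_[p])‖ * ‖x - 1‖ := by
    rw [norm_div, norm_mul, hn, div_le_iff₀ hq0]
    nlinarith [norm_nonneg (x - 1), mul_le_mul_of_nonneg_right ht.le (norm_nonneg (x - 1))]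
  rw [e, pow_sub_one hp hk]
  · exact (mul_le_of_le_one_left (norm_nonneg _) hk1).trans hle
  · refine hle.trans_lt ?_
    nlinarith [norm_nonneg (x - 1)]

lemma basin (hp : 3 ≤ p) {q k : ℕ} (hk : 1 ≤ k) (hq0 : 0 < ‖(q : ℚ_[p])‖) {θ x : ℚ_[p]}
    (hqk : ‖(q : ℚ_[p])‖ < ‖(k : ℚ_[p])‖) (ht : ‖θ - 1‖ < ‖(q : ℚ_[p])‖ ^ 2)
    (hx : ‖x - 1‖ < ‖(q : ℚ_[p])‖) :
    (∀ n : ℕ, (pottsBethe p q k θ)^[n] x ≠ 2 - (q : ℚ_[p]) - θ) ∧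
    Filter.Tendsto (fun n => (pottsBethe p q k θ)^[n] x) Filter.atTop (nhds 1) := by
  have hq1 := hqk.trans_le (nat_le_one (p := p) k)
  have h : ∀ n : ℕ, ‖(pottsBethe p q k θ)^[n] x - 1‖ < ‖(q : ℚ_[p])‖ ∧
      ‖(pottsBethe p q k θ)^[n] x - 1‖ ≤ ‖(q : ℚ_[p])‖ ^ n * ‖x - 1‖ := by
    intro n
    induction n with
    | zero => simpa using hx
    | succ n ih =>
      rw [Function.iterate_succ_apply']
      have := basin_step hp hk hq0 hqk ht ih.1
      constructor
      · nlinarith [ih.1, norm_nonneg ((pottsBethe p q k θ)^[n] x - 1)]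
      · refine this.trans ?_
        rw [pow_succ', mul_assoc]
        exact mul_le_mul_of_nonneg_left ih.2 hq0.le
  constructor
  · intro n hn
    have := basin_ne hq1 ht (h n).1
    rw [hn, sub_self, norm_zero] at this
    linarith
  · rw [tendsto_iff_norm_sub_tendsto_zero]
    refine squeeze_zero (fun _ => norm_nonneg _) (fun n => (h n).2) ?_
    simpa using (tendsto_pow_atTop_nhds_zero_of_lt_one hq0.le hq1).mul_const ‖x - 1‖

lemma pull {q k : ℕ} {θ x : ℚ_[p]} (hx : x ≠ 2 - (q : ℚ_[p]) - θ)
    (h : (∀ n : ℕ, (pottsBethe p q k θ)^[n] (pottsBethe p q k θ x) ≠ 2 - (q : ℚ_[p]) - θ) ∧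
    Filter.Tendsto (fun n => (pottsBethe p q k θ)^[n] (pottsBethe p q k θ x)) Filter.atTop (nhds 1)) :
    (∀ n : ℕ, (pottsBethe p q k θ)^[n] x ≠ 2 - (q : ℚ_[p]) - θ) ∧
    Filter.Tendsto (fun n => (pottsBethe p q k θ)^[n] x) Filter.atTop (nhds 1) := by
  constructor
  · rintro (_ | n)
    · exact hx
    · exact h.1 n
  · exact (Filter.tendsto_add_atTop_iff_nat 1).1 h.2

end PB
end

theorem stmt8 (p : ℕ) [Fact p.Prime] (hp : 3 ≤ p) (q k : ℕ) (hq : 1 ≤ q) (hk : 1 ≤ k)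
    (θ : ℚ_[p]) (hqk : ‖(q : ℚ_[p])‖ < ‖(k : ℚ_[p])‖) (hθq : ‖θ - 1‖ < ‖(q : ℚ_[p])‖ ^ 2)
    (x : ℚ_[p]) (hx : x ≠ 2 - (q : ℚ_[p]) - θ) (hxX : x ∉ XSet p q k θ) :
    (∀ n : ℕ, (pottsBethe p q k θ)^[n] x ≠ 2 - (q : ℚ_[p]) - θ) ∧
    Filter.Tendsto (fun n => (pottsBethe p q k θ)^[n] x) Filter.atTop (nhds 1) := by
  have hq0 : 0 < ‖(q : ℚ_[p])‖ := norm_pos_iff.2 (by exact_mod_cast (by omega : q ≠ 0))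
  have far : ∀ z : ℚ_[p], ‖(k : ℚ_[p]) * (θ - 1)‖ < ‖z - (2 - (q : ℚ_[p]) - θ)‖ →
      (∀ n : ℕ, (pottsBethe p q k θ)^[n] z ≠ 2 - (q : ℚ_[p]) - θ) ∧
      Filter.Tendsto (fun n => (pottsBethe p q k θ)^[n] z) Filter.atTop (nhds 1) := by
    intro z hz
    apply PB.pull
    · rintro rfl
      rw [sub_self, norm_zero] at hz
      exact absurd hz (not_lt.2 (norm_nonneg _))
    · exact PB.basin hp hk hq0 hqk hθq (PB.far_step hp hk hq0 hqk hθq hz)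
  rcases lt_or_ge ‖(k : ℚ_[p]) * (θ - 1)‖ ‖x - (2 - (q : ℚ_[p]) - θ)‖ with h | h
  · exact far x h
  · exact PB.pull hx (far _ (PB.first_step hp hk hq0 hqk hθq hx hxX h))
end

section
/- Let p ≥ 3 be a prime, let q, k ≥ 1 be natural numbers and θ ∈ ℚ_p with θ ≠ 1, |q|_p < |k|_p and |θ − 1|_p < |q|_p². Let J := ⋂_{n≥1} f^{−n}(X). Then f^{−1}(J) = J (so J is invariant under f), J is disjoint from ⋃_{n≥1} f^{−n}({2 − q − θ}), and for every x ∈ ℚ_p with x ≠ 2 − q − θ whose forward orbit never hits 2 − q − θ and which lies outside J, one has f^n(x) → 1 as n → ∞. -/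
open scoped Classical

section aux
variable {p : ℕ} [Fact p.Prime]

lemma aux_add_lt {a b : ℚ_[p]} {c : ℝ} (ha : ‖a‖ < c) (hb : ‖b‖ < c) : ‖a + b‖ < c :=
  lt_of_le_of_lt (Padic.nonarchimedean a b) (max_lt ha hb)

lemma aux_add_le {a b : ℚ_[p]} {c : ℝ} (ha : ‖a‖ ≤ c) (hb : ‖b‖ ≤ c) : ‖a + b‖ ≤ c :=
  le_trans (Padic.nonarchimedean a b) (max_le ha hb)

lemma aux_sub_lt {a b : ℚ_[p]} {c : ℝ} (ha : ‖a‖ < c) (hb : ‖b‖ < c) : ‖a - b‖ < c := by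
  rw [sub_eq_add_neg]; exact aux_add_lt ha (by simpa using hb)

lemma aux_sub_le {a b : ℚ_[p]} {c : ℝ} (ha : ‖a‖ ≤ c) (hb : ‖b‖ ≤ c) : ‖a - b‖ ≤ c := by
  rw [sub_eq_add_neg]; exact aux_add_le ha (by simpa using hb)

lemma aux_add_eq {a b : ℚ_[p]} (h : ‖b‖ < ‖a‖) : ‖a + b‖ = ‖a‖ := by
  rw [Padic.add_eq_max_of_ne h.ne', max_eq_left h.le]

lemma aux_sub_eq {a b : ℚ_[p]} (h : ‖b‖ < ‖a‖) : ‖a - b‖ = ‖a‖ := by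
  rw [sub_eq_add_neg]; exact aux_add_eq (by simpa using h)

lemma aux_nat_le (n : ℕ) : ‖(n : ℚ_[p])‖ ≤ 1 := by
  simpa using Padic.norm_int_le_one (p := p) (n : ℤ)

lemma aux_lt_one {w : ℚ_[p]} (hw : ‖w‖ < 1) : ‖w‖ ≤ (p : ℝ)⁻¹ := by
  have := (Padic.norm_le_pow_iff_norm_lt_pow_add_one w (-1)).2 (by simpa using hw)
  simpa using this

lemma aux_third (hp : 3 ≤ p) {w : ℚ_[p]} (hw : ‖w‖ < 1) : ‖w‖ ≤ 1 / 3 := by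
  refine (aux_lt_one hw).trans ?_
  rw [one_div]
  exact inv_anti₀ (by norm_num) (by exact_mod_cast hp)

lemma aux_two (hp : 3 ≤ p) : ‖(2 : ℚ_[p])‖ = 1 := by
  have h := Padic.norm_natCast_eq_one_iff (p := p) (n := 2)
  have : ‖((2 : ℕ) : ℚ_[p])‖ = 1 := h.2 ((Nat.coprime_primes Fact.out Nat.prime_two).2 (by omega))
  simpa using this

lemma aux_six (hp : 3 ≤ p) {w : ℚ_[p]} (hw : ‖w‖ < 1) : ‖w‖ ≤ ‖(6 : ℚ_[p])‖ := by
  have h6 : (6 : ℚ_[p]) = 2 * 3 := by norm_num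
  rw [h6, norm_mul, aux_two hp, one_mul]
  by_cases h : p = 3
  · subst h
    have := aux_lt_one hw
    have h3 := Padic.norm_p (p := 3)
    push_cast at this h3
    rw [h3]; exact this
  · have h' := Padic.norm_natCast_eq_one_iff (p := p) (n := 3)
    have : ‖((3 : ℕ) : ℚ_[p])‖ = 1 := h'.2 ((Nat.coprime_primes Fact.out Nat.prime_three).2 h)
    push_cast at this
    rw [this]; exact hw.le

lemma aux_inv_le {j : ℕ} (hj : j ≠ 0) : (1 : ℝ) / j ≤ ‖(j : ℚ_[p])‖ := by
  have hj' : (0 : ℝ) < j := by exact_mod_cast Nat.pos_of_ne_zero hj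
  have h := Padic.norm_eq_zpow_neg_valuation (p := p) (x := (j : ℚ_[p])) (by exact_mod_cast hj)
  rw [h, Padic.valuation_natCast, zpow_neg, zpow_natCast, one_div]
  have hp0 : (0 : ℝ) < p := by exact_mod_cast (Fact.out : p.Prime).pos
  refine inv_anti₀ (by positivity) ?_
  exact_mod_cast Nat.le_of_dvd (Nat.pos_of_ne_zero hj) pow_padicValNat_dvd

lemma aux_choose (k j : ℕ) (hj : j ≠ 0) :
    ‖(k.choose j : ℚ_[p])‖ ≤ ‖(k : ℚ_[p])‖ * j := by
  obtain ⟨j, rfl⟩ := Nat.exists_eq_succ_of_ne_zero hj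
  rcases k with _ | k
  · simp
  have h := Nat.add_one_mul_choose_eq k j
  have h2 : ‖((k + 1 : ℕ) : ℚ_[p])‖ * ‖(k.choose j : ℚ_[p])‖ =
      ‖((k+1).choose (j+1) : ℚ_[p])‖ * ‖((j + 1 : ℕ) : ℚ_[p])‖ := by
    rw [← norm_mul, ← norm_mul]; congr 1; exact_mod_cast h
  have h3 := aux_inv_le (p := p) (j := j + 1) (by omega)
  have h4 := aux_nat_le (p := p) (k.choose j)
  have hj' : (0 : ℝ) < (j + 1 : ℕ) := by positivity
  rw [div_le_iff₀ hj'] at h3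
  calc ‖((k+1).choose (j+1) : ℚ_[p])‖ ≤ 
        ‖((k+1).choose (j+1) : ℚ_[p])‖ * (‖((j + 1 : ℕ) : ℚ_[p])‖ * (j+1 : ℕ)) := 
          le_mul_of_one_le_right (norm_nonneg _) h3
    _ = ‖((k + 1 : ℕ) : ℚ_[p])‖ * ‖(k.choose j : ℚ_[p])‖ * (j+1 : ℕ) := by rw [h2]; ring
    _ ≤ ‖((k + 1 : ℕ) : ℚ_[p])‖ * 1 * (j+1 : ℕ) := by gcongr
    _ = _ := by simp

/-- Remainder estimate for the binomial expansion. -/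
lemma aux_rem (hp : 3 ≤ p) {k : ℕ} (hk : 1 ≤ k) {w : ℚ_[p]} (hw : ‖w‖ < 1) (hw0 : w ≠ 0)
    (m c : ℕ) (hmc : ∀ i : ℕ, (i + m) < 3 ^ (i + m - c)) (hcm : c ≤ m) (hm : m ≠ 0) :
    ‖∑ i ∈ Finset.range k, w ^ (i + m) * (k.choose (i + m) : ℚ_[p])‖ < ‖(k : ℚ_[p])‖ * ‖w‖ ^ c := by
  have hkp : 0 < ‖(k : ℚ_[p])‖ := norm_pos_iff.2 (by exact_mod_cast (by omega : k ≠ 0))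
  have hwp : 0 < ‖w‖ := norm_pos_iff.2 hw0
  have key : ∀ s : Finset ℕ, ‖∑ i ∈ s, w ^ (i + m) * (k.choose (i + m) : ℚ_[p])‖
      < ‖(k : ℚ_[p])‖ * ‖w‖ ^ c := by
    intro s
    induction s using Finset.induction_on with
    | empty => simp only [Finset.sum_empty, norm_zero]; positivity
    | insert i s hi ih =>
      rw [Finset.sum_insert hi]
      refine aux_add_lt ?_ ih
      rw [norm_mul, norm_pow]
      have h1 := aux_choose (p := p) k (i + m) (by omega)
      have h2 := aux_third hp hw
      have h3 : ‖w‖ ^ (i + m) = ‖w‖ ^ c * ‖w‖ ^ (i + m - c) := by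
        rw [← pow_add]; congr 1; omega
      have h4 : ‖w‖ ^ (i + m - c) ≤ (1/3 : ℝ) ^ (i + m - c) := by gcongr
      have h5 : (1/3 : ℝ) ^ (i + m - c) * ((i + m : ℕ) : ℝ) < 1 := by
        rw [one_div, inv_pow, inv_mul_lt_iff₀ (by positivity), mul_one]
        exact_mod_cast hmc i
      calc ‖w‖ ^ (i + m) * ‖(k.choose (i + m) : ℚ_[p])‖ 
          ≤ (‖w‖ ^ c * (1/3 : ℝ) ^ (i + m - c)) * (‖(k : ℚ_[p])‖ * ((i + m : ℕ) : ℝ)) := by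
            rw [h3]; gcongr
        _ = ‖(k : ℚ_[p])‖ * ‖w‖ ^ c * ((1/3 : ℝ) ^ (i + m - c) * ((i + m : ℕ) : ℝ)) := by ring
        _ < ‖(k : ℚ_[p])‖ * ‖w‖ ^ c * 1 := by gcongr
        _ = _ := by ring
  exact key _

lemma aux_expand (k m : ℕ) (hm : 1 ≤ m) (w : ℚ_[p]) :
    (1 + w) ^ k = ∑ i ∈ Finset.range m, w ^ i * (k.choose i : ℚ_[p]) +
      ∑ i ∈ Finset.range k, w ^ (i + m) * (k.choose (i + m) : ℚ_[p]) := by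
  have h : (1 + w) ^ k = ∑ i ∈ Finset.range (m + k), w ^ i * (k.choose i : ℚ_[p]) := by
    rw [add_comm 1 w, add_pow]
    simp only [one_pow, mul_one]
    apply Finset.sum_subset
    · intro i; simp; omega
    · intro i _ hi
      simp at hi
      rw [Nat.choose_eq_zero_of_lt (by omega)]; simp
  rw [h, Finset.sum_range_add]
  congr 1
  exact Finset.sum_congr rfl fun i _ => by rw [add_comm m i]

lemma aux_pow_sub_one (hp : 3 ≤ p) {k : ℕ} (hk : 1 ≤ k) {g : ℚ_[p]} (hg : ‖g - 1‖ < 1) :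
    ‖g ^ k - 1‖ = ‖(k : ℚ_[p])‖ * ‖g - 1‖ := by
  by_cases h0 : g = 1
  · simp [h0]
  have hw0 : g - 1 ≠ 0 := sub_ne_zero.2 h0
  have hr := aux_rem hp hk hg hw0 2 1 (fun i => by
    show i + 2 < 3 ^ (i + 1)
    induction i with
    | zero => norm_num
    | succ i ih => rw [pow_succ]; omega) (by norm_num) (by norm_num)
  have he := aux_expand k 2 (by norm_num) (g - 1)
  rw [add_sub_cancel] at he
  rw [he]
  simp only [Finset.sum_range_succ, Finset.sum_range_zero]
  simp only [pow_zero, Nat.choose_zero_right, Nat.choose_one_right, pow_one, zero_add, Nat.cast_one, one_mul] at hr ⊢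
  rw [show ∀ a b : ℚ_[p], 1 + a + b - 1 = a + b by intros; ring, aux_add_eq, norm_mul, mul_comm]
  rw [norm_mul, mul_comm]; exact hr

lemma aux_choose_three (k : ℕ) :
    (k.choose 3 : ℚ_[p]) = (k : ℚ_[p]) * (k - 1) * (k - 2) / 6 := by
  induction k with
  | zero => simp
  | succ n ih =>
    rw [Nat.choose_succ_succ' n 2, Nat.cast_add, ih, Nat.cast_choose_two]
    push_cast; field_simp; ring

lemma aux_T (hp : 3 ≤ p) {k : ℕ} (hk : 1 ≤ k) {w q s : ℚ_[p]} (hw : ‖w‖ < 1) (hw0 : w ≠ 0)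
    (h : (1 + w) ^ k = 1 - q + s) (hs : ‖s‖ < ‖(k : ℚ_[p])‖ * ‖w‖ ^ 2) :
    ‖q + (k - ((k : ℚ_[p]) - 1) * q / 2 + ((k : ℚ_[p]) - 1) * (k - 2) * q ^ 2 / (6 * k)) * w‖
      < ‖(k : ℚ_[p])‖ * ‖w‖ ^ 2 := by
  have hk0 : (k : ℚ_[p]) ≠ 0 := by exact_mod_cast (by omega : k ≠ 0)
  have hkp : 0 < ‖(k : ℚ_[p])‖ := norm_pos_iff.2 hk0
  have hwp : 0 < ‖w‖ := norm_pos_iff.2 hw0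
  have h2 := aux_two (p := p) hp
  have h6 := aux_six hp hw
  have h6p : 0 < ‖(6 : ℚ_[p])‖ := lt_of_lt_of_le hwp h6
  have hk1 : ‖(k : ℚ_[p])‖ ≤ 1 := aux_nat_le k
  have hkm1 : ‖(k : ℚ_[p]) - 1‖ ≤ 1 := aux_sub_le hk1 (by simp)
  have hkm2 : ‖(k : ℚ_[p]) - 2‖ ≤ 1 := aux_sub_le hk1 h2.le
  have hr := aux_rem hp hk hw hw0 4 2 (fun i => by
    show i + 4 < 3 ^ (i + 2)
    induction i with
    | zero => norm_num
    | succ i ih => rw [pow_succ]; omega) (by norm_num) (by norm_num)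
  have he := aux_expand k 4 (by norm_num) w
  set R := ∑ i ∈ Finset.range k, w ^ (i + 4) * (k.choose (i + 4) : ℚ_[p]) with hR
  simp only [Finset.sum_range_succ, Finset.sum_range_zero, aux_choose_three, Nat.cast_choose_two,
    pow_zero, Nat.choose_zero_right, Nat.choose_one_right, pow_one, zero_add, Nat.cast_one,
    one_mul] at he
  rw [h] at he
  clear_value R
  obtain ⟨d, hd⟩ : ∃ d, d = q + k * w := ⟨_, rfl⟩
  have hd2 : d = s - R - w ^ 2 * (k * (k - 1) / 2) - w ^ 3 * (k * (k - 1) * (k - 2) / 6) := by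
    rw [hd]; linear_combination -he
  have hdn : ‖d‖ ≤ ‖(k : ℚ_[p])‖ * ‖w‖ ^ 2 := by
    rw [hd2]
    refine aux_sub_le (aux_sub_le (aux_sub_le hs.le hr.le) ?_) ?_
    · rw [norm_mul, norm_div, norm_mul, h2, norm_pow, div_one]
      calc _ ≤ ‖w‖ ^ 2 * (‖(k : ℚ_[p])‖ * 1) := by gcongr
        _ = _ := by ring
    · rw [norm_mul, norm_div, norm_mul, norm_mul, norm_pow, ← mul_div_assoc, div_le_iff₀ h6p]
      calc _ ≤ ‖w‖ ^ 3 * (‖(k : ℚ_[p])‖ * 1 * 1) := by gcongr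
        _ = ‖(k : ℚ_[p])‖ * ‖w‖ ^ 2 * ‖w‖ := by ring
        _ ≤ _ := by gcongr
  have hT : q + (k - ((k : ℚ_[p]) - 1) * q / 2 + ((k : ℚ_[p]) - 1) * (k - 2) * q ^ 2 / (6 * k)) * w
      = s - R - (k - 1) * w * d / 2 + (k - 1) * (k - 2) * (w / 6) * (d * (d / k - 2 * w)) := by
    have hq : q = d - k * w := by rw [hd]; ring
    have hsR : s - R = d + w ^ 2 * (k * (k - 1) / 2) + w ^ 3 * (k * (k - 1) * (k - 2) / 6) := by
      rw [hd2]; ring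
    rw [hsR, hq]
    field_simp
    ring
  rw [hT]
  have hP : 0 < ‖(k : ℚ_[p])‖ * ‖w‖ ^ 2 := by positivity
  refine aux_add_lt (aux_sub_lt (aux_sub_lt hs hr) ?_) ?_
  · rw [norm_div, norm_mul, norm_mul, h2, div_one]
    calc _ ≤ 1 * ‖w‖ * (‖(k : ℚ_[p])‖ * ‖w‖ ^ 2) := by gcongr
      _ < 1 * 1 * (‖(k : ℚ_[p])‖ * ‖w‖ ^ 2) := by gcongr
      _ = _ := by ring
  · have hdk : ‖d / k - 2 * w‖ ≤ ‖w‖ := by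
      refine aux_sub_le ?_ ?_
      · rw [norm_div, div_le_iff₀ hkp]
        calc _ ≤ ‖(k : ℚ_[p])‖ * ‖w‖ ^ 2 := hdn
          _ = ‖w‖ * ‖(k : ℚ_[p])‖ * ‖w‖ := by ring
          _ ≤ ‖w‖ * ‖(k : ℚ_[p])‖ * 1 := by gcongr
          _ = _ := by ring
      · rw [norm_mul, h2, one_mul]
    have hw6 : ‖w / 6‖ ≤ 1 := by rw [norm_div]; exact (div_le_one h6p).2 h6
    rw [norm_mul, norm_mul, norm_mul, norm_mul]
    calc _ ≤ 1 * 1 * 1 * ((‖(k : ℚ_[p])‖ * ‖w‖ ^ 2) * ‖w‖) := by gcongr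
      _ < 1 * 1 * 1 * ((‖(k : ℚ_[p])‖ * ‖w‖ ^ 2) * 1) := by gcongr
      _ = _ := by ring

lemma aux_toZMod (x : ℤ_[p]) : PadicInt.toZMod x = 0 ↔ ‖x‖ < 1 := by
  rw [← RingHom.mem_ker, PadicInt.ker_toZMod, PadicInt.maximalIdeal_eq_span_p,
    Ideal.mem_span_singleton, PadicInt.norm_lt_one_iff_dvd]

/-- Teichmüller: a unit whose `k`-th power is close to `1` is close to a `k`-th root of unity. -/
lemma aux_root {k : ℕ} (hk : 1 ≤ k) {g : ℚ_[p]} (hg : ‖g‖ ≤ 1) (h : ‖g ^ k - 1‖ < 1) :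
    ∃ ξ : ℚ_[p], ξ ^ k = 1 ∧ ‖ξ - g‖ < 1 := by
  obtain ⟨a, m, hm, rfl⟩ := Nat.exists_eq_pow_mul_and_not_dvd (n := k) (by omega) p
    (Fact.out : p.Prime).ne_one
  let G : ℤ_[p] := ⟨g, hg⟩
  have h1 : ‖G ^ (p ^ a * m) - 1‖ < 1 := by
    rw [PadicInt.norm_def]; push_cast; exact h
  have h2 : PadicInt.toZMod (G ^ (p ^ a * m) - 1) = 0 := (aux_toZMod _).2 h1
  have h3 : PadicInt.toZMod (G ^ m - 1) = 0 := by
    rw [map_sub, map_pow, map_one, pow_mul, ZMod.pow_card_pow] at h2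
    rw [map_sub, map_pow, map_one]; exact h2
  have h4 : ‖G ^ m - 1‖ < 1 := (aux_toZMod _).1 h3
  have hm1 : ‖(m : ℤ_[p])‖ = 1 := by
    rw [PadicInt.norm_natCast_eq_one_iff]
    exact ((Fact.out : p.Prime).coprime_iff_not_dvd).2 hm
  have hm0 : m ≠ 0 := by rintro rfl; simp at hm
  have hG : ‖G‖ = 1 := by
    refine le_antisymm (PadicInt.norm_le_one _) (not_lt.1 fun hlt => ?_)
    rw [← aux_toZMod] at hlt
    rw [map_sub, map_pow, map_one, hlt, zero_pow hm0] at h3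
    simp at h3
  have hder : ‖(Polynomial.derivative (Polynomial.X ^ m - 1 : Polynomial ℤ_[p])).aeval G‖ = 1 := by
    simp [Polynomial.derivative_X_pow, hm1, hG]
  obtain ⟨z, hz, hz2, -, -⟩ := hensels_lemma (p := p)
    (F := (Polynomial.X ^ m - 1 : Polynomial ℤ_[p])) (a := G) (by
      rw [hder]; simpa using h4)
  rw [hder] at hz2
  refine ⟨z, ?_, ?_⟩
  · have : z ^ m = 1 := by simpa [sub_eq_zero] using hz
    have h5 : (z : ℚ_[p]) ^ m = 1 := by exact_mod_cast congrArg (fun y : ℤ_[p] => (y : ℚ_[p])) this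
    rw [mul_comm, pow_mul, h5, one_pow]
  · rw [PadicInt.norm_def] at hz2; simpa using hz2

variable {q k : ℕ} {θ : ℚ_[p]}

/-- Standing consequences of the hypotheses. -/
structure Hyp (p : ℕ) [Fact p.Prime] (q k : ℕ) (θ : ℚ_[p]) : Prop where
  hp : 3 ≤ p
  hk : 1 ≤ k
  q0 : 0 < ‖(q : ℚ_[p])‖
  t0 : 0 < ‖θ - 1‖
  qk : ‖(q : ℚ_[p])‖ < ‖(k : ℚ_[p])‖
  tq : ‖θ - 1‖ < ‖(q : ℚ_[p])‖ ^ 2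
  q1 : ‖(q : ℚ_[p])‖ < 1
  k1 : ‖(k : ℚ_[p])‖ ≤ 1
  tq' : ‖θ - 1‖ < ‖(q : ℚ_[p])‖
  t1 : ‖θ - 1‖ < 1

lemma aux_f_eq {x : ℚ_[p]} (hx : x + θ + q - 2 ≠ 0) :
    pottsBethe p q k θ x = (1 + (θ - 1) * (x - 1) / (x + θ + q - 2)) ^ k := by
  unfold pottsBethe
  congr 1
  field_simp
  ring

lemma aux_f_close (H : Hyp p q k θ) {x : ℚ_[p]} (hx : x + θ + q - 2 ≠ 0)
    (h : ‖(θ - 1) * (x - 1) / (x + θ + q - 2)‖ < 1) :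
    ‖pottsBethe p q k θ x - 1‖ = ‖(k : ℚ_[p])‖ * (‖θ - 1‖ * ‖x - 1‖ / ‖x + θ + q - 2‖) := by
  rw [aux_f_eq hx, aux_pow_sub_one H.hp H.hk (by simpa using h)]
  simp

lemma aux_D (H : Hyp p q k θ) {x : ℚ_[p]} (hx : ‖x - 1‖ < ‖(q : ℚ_[p])‖) :
    ‖pottsBethe p q k θ x - 1‖ ≤ ‖(q : ℚ_[p])‖ * ‖x - 1‖ := by
  have hu : ‖x + θ + q - 2‖ = ‖(q : ℚ_[p])‖ := by
    rw [show x + θ + q - 2 = q + ((x - 1) + (θ - 1)) by ring]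
    exact aux_add_eq (aux_add_lt hx H.tq')
  have hu0 : x + θ + q - 2 ≠ 0 := norm_pos_iff.1 (hu ▸ H.q0)
  have hq := H.q0
  have h1 : ‖θ - 1‖ * ‖x - 1‖ / ‖x + θ + q - 2‖ ≤ ‖(q : ℚ_[p])‖ * ‖x - 1‖ := by
    rw [hu, div_le_iff₀ hq]
    calc _ ≤ ‖(q : ℚ_[p])‖ ^ 2 * ‖x - 1‖ := by gcongr; exact H.tq.le
      _ = _ := by ring
  rw [aux_f_close H hu0]
  · calc _ ≤ 1 * (‖(q : ℚ_[p])‖ * ‖x - 1‖) := by gcongr; exact H.k1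
      _ = _ := one_mul _
  · rw [norm_div, norm_mul]
    refine h1.trans_lt ?_
    have := H.q1
    nlinarith [norm_nonneg (x - 1)]

lemma aux_A (H : Hyp p q k θ) {x : ℚ_[p]}
    (hx : ‖(k : ℚ_[p])‖ * ‖θ - 1‖ < ‖x + θ + q - 2‖) :
    ‖pottsBethe p q k θ x - 1‖ < ‖(q : ℚ_[p])‖ := by
  have hk0 : 0 < ‖(k : ℚ_[p])‖ := H.q0.trans H.qk
  have ht0 := H.t0
  have hup : 0 < ‖x + θ + q - 2‖ := lt_of_le_of_lt (by positivity) hx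
  have hu0 : x + θ + q - 2 ≠ 0 := norm_pos_iff.1 hup
  have hx1 : x - 1 = (x + θ + q - 2) - (q + (θ - 1)) := by ring
  have hqt : ‖(q : ℚ_[p]) + (θ - 1)‖ = ‖(q : ℚ_[p])‖ := aux_add_eq H.tq'
  rcases le_or_gt ‖(q : ℚ_[p])‖ ‖x + θ + q - 2‖ with h | h
  · have hx2 : ‖x - 1‖ ≤ ‖x + θ + q - 2‖ := by
      rw [hx1]; exact aux_sub_le le_rfl (hqt.le.trans h)
    have h1 : ‖θ - 1‖ * ‖x - 1‖ / ‖x + θ + q - 2‖ ≤ ‖θ - 1‖ := by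
      rw [div_le_iff₀ hup]; gcongr
    rw [aux_f_close H hu0]
    · calc _ ≤ 1 * ‖θ - 1‖ := by gcongr; exact H.k1
        _ < _ := by rw [one_mul]; exact H.tq'
    · rw [norm_div, norm_mul]; exact h1.trans_lt H.t1
  · have hx2 : ‖x - 1‖ = ‖(q : ℚ_[p])‖ := by
      rw [hx1, norm_sub_rev, ← hqt]; exact aux_sub_eq (by rw [hqt]; exact h)
    have h1 : ‖(k : ℚ_[p])‖ * (‖θ - 1‖ * ‖x - 1‖ / ‖x + θ + q - 2‖) < ‖(q : ℚ_[p])‖ := by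
      rw [hx2, ← mul_div_assoc, div_lt_iff₀ hup]
      nlinarith [H.q0]
    rw [aux_f_close H hu0]
    · exact h1
    · rw [norm_div, norm_mul]
      by_contra hc
      have := H.qk
      nlinarith [not_lt.1 hc]

lemma aux_K (H : Hyp p q k θ) : ‖(k : ℚ_[p]) - ((k : ℚ_[p]) - 1) * q / 2 +
    ((k : ℚ_[p]) - 1) * (k - 2) * q ^ 2 / (6 * k)‖ ≤ 1 := by
  have hk0 : 0 < ‖(k : ℚ_[p])‖ := H.q0.trans H.qk
  have h2 := aux_two (p := p) H.hp
  have hw : ‖(q : ℚ_[p]) / k‖ < 1 := by rw [norm_div, div_lt_one hk0]; exact H.qk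
  have h6 := aux_six H.hp hw
  have h6p : 0 < ‖(6 : ℚ_[p])‖ := norm_pos_iff.2 (by norm_num)
  have hkm1 : ‖(k : ℚ_[p]) - 1‖ ≤ 1 := aux_sub_le H.k1 (by simp)
  have hkm2 : ‖(k : ℚ_[p]) - 2‖ ≤ 1 := aux_sub_le H.k1 h2.le
  refine aux_add_le (aux_sub_le H.k1 ?_) ?_
  · rw [norm_div, h2, div_one, norm_mul]
    exact mul_le_one₀ hkm1 (norm_nonneg _) H.q1.le
  · have h7 : ‖(q : ℚ_[p]) / k / 6‖ ≤ 1 := by rw [norm_div _ (6 : ℚ_[p])]; exact (div_le_one h6p).2 h6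
    rw [show ((k : ℚ_[p]) - 1) * (k - 2) * q ^ 2 / (6 * k) =
      (k - 1) * (k - 2) * q * (q / k / 6) by
        have : (k : ℚ_[p]) ≠ 0 := norm_pos_iff.1 hk0
        field_simp, norm_mul, norm_mul, norm_mul]
    have := H.q1.le
    calc _ ≤ (1 : ℝ) * 1 * 1 * 1 := by gcongr
      _ = 1 := by norm_num

lemma aux_center_one (H : Hyp p q k θ) : xiCenter p q k θ 1 + θ + q - 2 =
    (θ - 1) * ((k : ℚ_[p]) - ((k : ℚ_[p]) - 1) * q / 2 +
      ((k : ℚ_[p]) - 1) * (k - 2) * q ^ 2 / (6 * k)) := by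
  have : (k : ℚ_[p]) ≠ 0 := norm_pos_iff.1 (H.q0.trans H.qk)
  simp only [xiCenter, if_true]
  field_simp
  ring

lemma aux_X (H : Hyp p q k θ) {x : ℚ_[p]} (hx : x ∈ XSet p q k θ) :
    ‖x + θ + q - 2‖ < ‖(q : ℚ_[p])‖ := by
  obtain ⟨ξ, hξ, h⟩ := hx
  rw [show x + θ + q - 2 = (x - xiCenter p q k θ ξ) + (xiCenter p q k θ ξ + θ + q - 2) by ring]
  have hq := H.q0
  refine aux_add_lt (h.trans ?_) ?_
  · rw [norm_mul]; have := H.t1; nlinarith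
  by_cases h1 : ξ = 1
  · subst h1
    rw [aux_center_one H, norm_mul]
    calc _ ≤ ‖θ - 1‖ * 1 := by gcongr; exact aux_K H
      _ < _ := by rw [mul_one]; exact H.tq'
  · have h2 : 1 ≤ ‖1 - ξ‖ := by
      by_contra hc
      have h3 := aux_pow_sub_one H.hp H.hk (g := ξ) (by rw [norm_sub_rev]; exact not_le.1 hc)
      rw [hξ, sub_self, norm_zero] at h3
      have h4 : 0 < ‖ξ - 1‖ := norm_pos_iff.2 (sub_ne_zero.2 h1)
      have h5 : 0 < ‖(k : ℚ_[p])‖ := H.q0.trans H.qk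
      have := mul_pos h5 h4
      linarith
    rw [show xiCenter p q k θ ξ + θ + q - 2 = q * (θ - 1) / (1 - ξ) by
      simp only [xiCenter, if_neg h1]; ring, norm_div, norm_mul]
    rw [div_lt_iff₀ (by linarith)]
    have := H.t1
    nlinarith

lemma aux_zero (H : Hyp p q k θ) : ‖(0 : ℚ_[p]) + θ + q - 2‖ = 1 := by
  rw [show (0 : ℚ_[p]) + θ + q - 2 = -1 + ((θ - 1) + q) by ring, aux_add_eq]
  · simp
  · simpa using aux_add_lt H.t1 H.q1

lemma aux_f_pole (H : Hyp p q k θ) {x : ℚ_[p]} (hx : x + θ + q - 2 = 0) :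
    pottsBethe p q k θ x = 0 := by
  have := H.hk
  simp [pottsBethe, hx]; omega

lemma aux_B (H : Hyp p q k θ) {x : ℚ_[p]}
    (hx : ‖pottsBethe p q k θ x + θ + q - 2‖ ≤ ‖(k : ℚ_[p])‖ * ‖θ - 1‖) :
    x ∈ XSet p q k θ := by
  have hq := H.q0
  have ht := H.t0
  have hk0 : 0 < ‖(k : ℚ_[p])‖ := H.q0.trans H.qk
  have hkt : ‖(k : ℚ_[p])‖ * ‖θ - 1‖ ≤ ‖θ - 1‖ := mul_le_of_le_one_left ht.le H.k1
  by_cases hu : x + θ + q - 2 = 0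
  · rw [aux_f_pole H hu, aux_zero H] at hx
    have := H.t1
    linarith
  obtain ⟨u, hue⟩ : ∃ u, u = x + θ + q - 2 := ⟨_, rfl⟩
  rw [← hue] at hu
  obtain ⟨w, hw⟩ : ∃ w, w = (θ - 1) * (x - 1) / u := ⟨_, rfl⟩
  have hf : pottsBethe p q k θ x = (1 + w) ^ k := by
    rw [aux_f_eq (by rwa [← hue]), ← hue, ← hw]
  obtain ⟨s, hs⟩ : ∃ s, s = (1 + w) ^ k - (1 - q) := ⟨_, rfl⟩
  have hsn : ‖s‖ ≤ ‖θ - 1‖ := by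
    rw [show s = (pottsBethe p q k θ x + θ + q - 2) - (θ - 1) by rw [hf, hs]; ring]
    exact aux_sub_le (hx.trans hkt) le_rfl
  have hy : (1 + w) ^ k = 1 - q + s := by rw [hs]; ring
  have hyq : ‖(1 + w) ^ k - 1‖ = ‖(q : ℚ_[p])‖ := by
    rw [hy, show (1 : ℚ_[p]) - q + s - 1 = -(q - s) by ring, norm_neg]
    exact aux_sub_eq (hsn.trans_lt H.tq')
  have hqt : ‖(q : ℚ_[p]) + (θ - 1)‖ = ‖(q : ℚ_[p])‖ := aux_add_eq H.tq'
  have huw : u * (w - (θ - 1)) = -(θ - 1) * (q + (θ - 1)) := by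
    rw [mul_sub, hw, mul_div_cancel₀ _ hu, hue]; ring
  have hw1 : ‖w‖ ≤ 1 := by
    by_contra hc
    have hc := not_le.1 hc
    have h1 : ‖1 + w‖ = ‖w‖ := by rw [add_comm]; exact aux_add_eq (by simpa using hc)
    have h2 : 1 < ‖(1 + w) ^ k‖ := by
      rw [norm_pow, h1]; exact one_lt_pow₀ hc (by have := H.hk; omega)
    have h3 : ‖(1 + w) ^ k - 1‖ = ‖(1 + w) ^ k‖ := aux_sub_eq (by simpa using h2)
    have := H.q1
    linarith
  rcases lt_or_eq_of_le hw1 with hw1 | hw1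
  · have hkw : ‖(k : ℚ_[p])‖ * ‖w‖ = ‖(q : ℚ_[p])‖ := by
      have := aux_pow_sub_one H.hp H.hk (g := 1 + w) (by simpa using hw1)
      rw [hyq] at this; simpa using this.symm
    have hwp : 0 < ‖w‖ := by
      by_contra hc
      have : ‖w‖ = 0 := le_antisymm (not_lt.1 hc) (norm_nonneg _)
      rw [this] at hkw; simp at hkw; linarith
    have hqw : ‖(q : ℚ_[p])‖ ≤ ‖w‖ := by
      rw [← hkw]; exact mul_le_of_le_one_left hwp.le H.k1
    have hP : ‖(k : ℚ_[p])‖ * ‖w‖ ^ 2 = ‖(q : ℚ_[p])‖ * ‖w‖ := by rw [← hkw]; ring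
    have htP : ‖θ - 1‖ < ‖(k : ℚ_[p])‖ * ‖w‖ ^ 2 := by
      rw [hP]; refine H.tq.trans_le ?_; rw [sq]; gcongr
    have hT := aux_T H.hp H.hk hw1 (norm_pos_iff.1 hwp) hy (hsn.trans_lt htP)
    have hK := aux_K H
    have hC := aux_center_one H
    set K := (k : ℚ_[p]) - ((k : ℚ_[p]) - 1) * q / 2 +
      ((k : ℚ_[p]) - 1) * (k - 2) * q ^ 2 / (6 * k) with hKdef
    clear_value K
    refine ⟨1, one_pow k, ?_⟩
    have hwt : ‖w - (θ - 1)‖ = ‖w‖ := aux_sub_eq (H.tq'.trans_le hqw)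
    have e : (x - xiCenter p q k θ 1) * (w - (θ - 1)) =
        -((θ - 1) * ((q + K * w) + (θ - 1) * (1 - K))) := by
      have : x - xiCenter p q k θ 1 = u - (θ - 1) * K := by rw [← hC, hue]; ring
      rw [this, sub_mul, huw]; ring
    have e2 := congrArg norm e
    rw [norm_mul, norm_neg, norm_mul, hwt] at e2
    have e3 : ‖(q + K * w) + (θ - 1) * (1 - K)‖ < ‖(k : ℚ_[p])‖ * ‖w‖ ^ 2 := by
      refine aux_add_lt hT ?_
      rw [norm_mul]
      refine lt_of_le_of_lt ?_ htP
      exact mul_le_of_le_one_right ht.le (aux_sub_le (by simp) hK)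
    rw [hP] at e3
    rw [norm_mul]
    have e4 : ‖x - xiCenter p q k θ 1‖ * ‖w‖ < ‖(q : ℚ_[p])‖ * ‖θ - 1‖ * ‖w‖ := by
      rw [e2]; nlinarith
    exact lt_of_mul_lt_mul_right e4 hwp.le
  · obtain ⟨ξ, hξ, hξg⟩ := aux_root H.hk (g := 1 + w) (aux_add_le (by simp) hw1.le)
      (hyq.trans_lt H.q1)
    have hξ1 : ‖1 - ξ‖ = 1 := by
      rw [show 1 - ξ = -(w + (ξ - (1 + w))) by ring, norm_neg, aux_add_eq (by rwa [hw1]), hw1]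
    have hne : ξ ≠ 1 := by rintro rfl; simp at hξ1
    have hne' : 1 - ξ ≠ 0 := sub_ne_zero.2 (Ne.symm hne)
    refine ⟨ξ, hξ, ?_⟩
    have hwt : ‖w - (θ - 1)‖ = 1 := by rw [aux_sub_eq (by rw [hw1]; exact H.t1), hw1]
    have e : (x - xiCenter p q k θ ξ) * (w - (θ - 1)) * (1 - ξ) =
        (θ - 1) * (q * (ξ - (1 + w)) + (θ - 1) * (ξ - 1 + q)) := by
      have : (x - xiCenter p q k θ ξ) * (1 - ξ) = u * (1 - ξ) - q * (θ - 1) := by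
        simp only [xiCenter, if_neg hne]; rw [hue]; field_simp; ring
      rw [mul_right_comm, this, sub_mul, mul_right_comm, huw]; ring
    have e2 := congrArg norm e
    rw [norm_mul, norm_mul, norm_mul, hwt, hξ1, mul_one, mul_one] at e2
    rw [e2, norm_mul, mul_comm ‖(q : ℚ_[p])‖]
    refine mul_lt_mul_of_pos_left (aux_add_lt ?_ ?_) ht
    · rw [norm_mul]; nlinarith
    · rw [norm_mul]
      refine lt_of_le_of_lt (mul_le_of_le_one_right ht.le ?_) H.tq'
      refine aux_add_le ?_ H.q1.le
      rw [norm_sub_rev]; exact hξ1.le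

lemma aux_notX (H : Hyp p q k θ) {x : ℚ_[p]} (hx : x ∉ XSet p q k θ) :
    ‖pottsBethe p q k θ (pottsBethe p q k θ x) - 1‖ < ‖(q : ℚ_[p])‖ :=
  aux_A H (not_le.1 fun h => hx (aux_B H h))

lemma aux_D_notX (H : Hyp p q k θ) {x : ℚ_[p]} (hx : ‖x - 1‖ < ‖(q : ℚ_[p])‖) :
    x ∉ XSet p q k θ := by
  intro h
  have h1 := aux_X H h
  have h2 : ‖(q : ℚ_[p])‖ < ‖(q : ℚ_[p])‖ := by
    conv_lhs => rw [show (q : ℚ_[p]) = (x + θ + q - 2) - ((x - 1) + (θ - 1)) by ring]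
    exact aux_sub_lt h1 (aux_add_lt hx H.tq')
  exact lt_irrefl _ h2

lemma aux_tendsto (H : Hyp p q k θ) {x : ℚ_[p]} (hx : ‖x - 1‖ < ‖(q : ℚ_[p])‖) :
    Filter.Tendsto (fun n => (pottsBethe p q k θ)^[n] x) Filter.atTop (nhds 1) := by
  have h : ∀ n, ‖(pottsBethe p q k θ)^[n] x - 1‖ ≤ ‖(q : ℚ_[p])‖ ^ n * ‖x - 1‖ := by
    intro n
    induction n with
    | zero => simp
    | succ n ih =>
      rw [Function.iterate_succ_apply']
      have h1 : ‖(q : ℚ_[p])‖ ^ n * ‖x - 1‖ ≤ ‖x - 1‖ :=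
        mul_le_of_le_one_left (norm_nonneg _) (pow_le_one₀ (norm_nonneg _) H.q1.le)
      refine (aux_D H ((ih.trans h1).trans_lt hx)).trans ?_
      rw [pow_succ', mul_assoc]
      gcongr
  rw [tendsto_iff_norm_sub_tendsto_zero]
  refine squeeze_zero (fun _ => norm_nonneg _) h ?_
  have := (tendsto_pow_atTop_nhds_zero_of_lt_one (norm_nonneg _) H.q1).mul_const ‖x - 1‖
  simpa using this

end aux

theorem stmt9 (p : ℕ) [Fact p.Prime] (hp : 3 ≤ p) (q k : ℕ) (hq : 1 ≤ q) (hk : 1 ≤ k)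
    (θ : ℚ_[p]) (hθ1 : θ ≠ 1) (hqk : ‖(q : ℚ_[p])‖ < ‖(k : ℚ_[p])‖)
    (hθq : ‖θ - 1‖ < ‖(q : ℚ_[p])‖ ^ 2) :
    pottsBethe p q k θ ⁻¹' JSet p q k θ = JSet p q k θ ∧
    (∀ x ∈ JSet p q k θ, ∀ n : ℕ, 1 ≤ n →
      (pottsBethe p q k θ)^[n] x ≠ 2 - (q : ℚ_[p]) - θ) ∧
    (∀ x : ℚ_[p], x ≠ 2 - (q : ℚ_[p]) - θ →
      (∀ n : ℕ, (pottsBethe p q k θ)^[n] x ≠ 2 - (q : ℚ_[p]) - θ) →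
      x ∉ JSet p q k θ →
      Filter.Tendsto (fun n => (pottsBethe p q k θ)^[n] x) Filter.atTop (nhds 1)) := by
  have hq0 : 0 < ‖(q : ℚ_[p])‖ := norm_pos_iff.2 (by exact_mod_cast (by omega : q ≠ 0))
  have hk1 : ‖(k : ℚ_[p])‖ ≤ 1 := aux_nat_le k
  have hq1 : ‖(q : ℚ_[p])‖ < 1 := hqk.trans_le hk1
  have htq' : ‖θ - 1‖ < ‖(q : ℚ_[p])‖ := by nlinarith
  have H : Hyp p q k θ := ⟨hp, hk, hq0, norm_pos_iff.2 (sub_ne_zero.2 hθ1), hqk, hθq, hq1, hk1,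
    htq', htq'.trans hq1⟩
  have hJ : ∀ x, x ∈ JSet p q k θ ↔ ∀ n, 1 ≤ n → (pottsBethe p q k θ)^[n] x ∈ XSet p q k θ := by
    intro x; simp [JSet]
  refine ⟨?_, ?_, ?_⟩
  · ext x
    rw [Set.mem_preimage, hJ, hJ]
    constructor
    · intro h n hn
      obtain ⟨n, rfl⟩ := Nat.exists_eq_add_of_le' hn
      rw [Function.iterate_succ_apply]
      rcases n with _ | n
      · by_contra hc
        exact aux_D_notX H (aux_notX H hc) (h 2 (by norm_num))
      · exact h (n + 1) (by omega)
    · intro h n hn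
      have := h (n + 1) (by omega)
      rwa [Function.iterate_succ_apply] at this
  · intro x hx n hn he
    have h1 := (hJ x).1 hx (n + 1) (by omega)
    rw [Function.iterate_succ_apply', he, aux_f_pole H (by ring)] at h1
    have h2 := aux_X H h1
    rw [aux_zero H] at h2
    linarith
  · intro x _ _ hx
    rw [hJ] at hx
    push Not at hx
    obtain ⟨n, hn, hx⟩ := hx
    have h1 := aux_tendsto H (aux_notX H hx)
    rw [← Filter.tendsto_add_atTop_iff_nat (n + 2)]
    refine h1.congr fun m => ?_
    rw [Function.iterate_add_apply, add_comm n 2, Function.iterate_add_apply]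
    rfl
end

section
/- Let p ≥ 3 be a prime, let q, k ≥ 1 be natural numbers with |q|_p < |k|_p ≤ 1 and |q|_p < 1, and let a ∈ ℚ_p with |a − (1 − q)|_p < |q|_p². Then the unique solution x_* ∈ 𝓔_p of x^k = a satisfies |x_* − 1 + q/k + (k−1)·q²/(2k²) − (k−1)(k−2)·q³/(6k³)|_p < |q²/k²|_p. -/
lemma aux_nat (p : ℕ) [Fact p.Prime] (n m : ℕ) (hm : 0 < m) (h : m < p ^ (n + 1)) :
    ((p : ℝ)⁻¹) ^ n ≤ ‖(m : ℚ_[p])‖ := by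
  by_contra hc
  push Not at hc
  have h1 : ‖(m : ℚ_[p])‖ < (p : ℝ) ^ (-(n + 1 : ℕ) + 1 : ℤ) := by
    refine hc.trans_le (le_of_eq ?_)
    have : (-((n + 1 : ℕ) : ℤ) + 1) = -(n : ℤ) := by push_cast; ring
    rw [this, zpow_neg, zpow_natCast, inv_pow]
  rw [← Padic.norm_le_pow_iff_norm_lt_pow_add_one] at h1
  have h2 := (Padic.norm_int_le_pow_iff_dvd (p := p) (m : ℤ) (n + 1)).1 (by exact_mod_cast h1)
  have h3 : p ^ (n + 1) ∣ m := by exact_mod_cast h2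
  exact absurd (Nat.le_of_dvd hm h3) (by omega)

lemma aux_small (p : ℕ) [Fact p.Prime] (y : ℚ_[p]) (h : ‖y‖ < 1) : ‖y‖ ≤ (p : ℝ)⁻¹ := by
  have := (Padic.norm_le_pow_iff_norm_lt_pow_add_one y (-1)).2 (by simpa using h)
  simpa using this

lemma aux_add {p : ℕ} [Fact p.Prime] {u v : ℚ_[p]} {c : ℝ} (hu : ‖u‖ ≤ c) (hv : ‖v‖ ≤ c) :
    ‖u + v‖ ≤ c := (Padic.nonarchimedean u v).trans (max_le hu hv)

lemma aux_add_lt_s13 {p : ℕ} [Fact p.Prime] {u v : ℚ_[p]} {c : ℝ} (hu : ‖u‖ < c) (hv : ‖v‖ < c) :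
    ‖u + v‖ < c := (Padic.nonarchimedean u v).trans_lt (max_lt hu hv)

lemma aux_exp (p : ℕ) [Fact p.Prime] (hp : 3 ≤ p) (k : ℕ) (hk : 1 ≤ k) (y : ℚ_[p])
    (hy : ‖y‖ < 1) : ∃ R : ℚ_[p], ‖R‖ ≤ ‖y‖ ^ 3 ∧
      (1 + y) ^ k = 1 + k * (y + (k - 1) / 2 * y ^ 2 + (k - 1) * (k - 2) / 6 * y ^ 3 + R) := by
  obtain ⟨m, rfl⟩ : ∃ m, k = m + 1 := ⟨k - 1, by omega⟩
  have hys := aux_small p y hy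
  refine ⟨∑ j ∈ Finset.range (m + 1),
    (m.choose (j + 3) : ℚ_[p]) / ((j + 4 : ℕ) : ℚ_[p]) * y ^ (j + 4), ?_, ?_⟩
  · refine IsUltrametricDist.norm_sum_le_of_forall_le_of_nonneg (by positivity) ?_
    intro j hj
    clear hj
    have hpow : j + 4 < 3 ^ (j + 2) := by
      induction j with
      | zero => norm_num
      | succ n ih => rw [show n + 1 + 2 = (n + 2) + 1 by ring, pow_succ]; omega
    have h1 := aux_nat p (j + 1) (j + 4) (by omega)
      (hpow.trans_le (Nat.pow_le_pow_left hp _))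
    have h2 : ‖y‖ ^ (j + 1) ≤ ‖((j + 4 : ℕ) : ℚ_[p])‖ :=
      (pow_le_pow_left₀ (norm_nonneg _) hys _).trans h1
    have h3 : ‖(m.choose (j + 3) : ℚ_[p])‖ ≤ 1 := by
      exact_mod_cast Padic.norm_int_le_one (p := p) (m.choose (j + 3) : ℤ)
    have h4 : 0 < ‖((j + 4 : ℕ) : ℚ_[p])‖ := norm_pos_iff.2 (Nat.cast_ne_zero.2 (by omega))
    rw [norm_mul, norm_div, norm_pow, show j + 4 = (j + 1) + 3 by ring, pow_add]
    rw [show j + 1 + 3 = j + 4 by ring, ← mul_assoc]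
    have h5 : ‖(m.choose (j + 3) : ℚ_[p])‖ / ‖((j + 4 : ℕ) : ℚ_[p])‖ * ‖y‖ ^ (j + 1) ≤ 1 := by
      rw [div_mul_eq_mul_div, div_le_one h4]
      calc _ ≤ 1 * ‖y‖ ^ (j + 1) := by gcongr
        _ ≤ _ := by rwa [one_mul]
    calc _ ≤ 1 * ‖y‖ ^ 3 := by gcongr
      _ = _ := one_mul _
  · have h1 : (1 + y) ^ (m + 1) =
        ∑ j ∈ Finset.range (m + 1 + 4), y ^ j * ((m + 1).choose j : ℚ_[p]) := by
      rw [add_comm 1 y, add_pow]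
      simp only [one_pow, mul_one]
      refine Finset.sum_subset (by intro i; simp; omega) ?_
      intro i _ hi
      rw [Nat.choose_eq_zero_of_lt (by simpa using hi)]; simp
    have key : ∀ j : ℕ, ((m + 1).choose (j + 1) : ℚ_[p]) =
        (m + 1) * (m.choose j) / (j + 1 : ℕ) := by
      intro j
      have := Nat.add_one_mul_choose_eq m j
      rw [eq_div_iff (Nat.cast_ne_zero.2 (by omega))]
      exact_mod_cast this.symm
    have c2 : (m.choose 2 : ℚ_[p]) = m * (m - 1) / 2 := Nat.cast_choose_two _ m
    rw [h1]
    simp only [Finset.sum_range_succ' _ (m + 1 + 3), Finset.sum_range_succ' _ (m + 1 + 2),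
      Finset.sum_range_succ' _ (m + 1 + 1), Finset.sum_range_succ' _ (m + 1), key]
    have hs : ∑ j ∈ Finset.range (m + 1), y ^ (j + 1 + 1 + 1 + 1) *
        (((m : ℚ_[p]) + 1) * (m.choose (j + 1 + 1 + 1)) / ((j + 1 + 1 + 1 + 1 : ℕ) : ℚ_[p])) =
        (m + 1) * ∑ j ∈ Finset.range (m + 1),
    (m.choose (j + 3) : ℚ_[p]) / ((j + 4 : ℕ) : ℚ_[p]) * y ^ (j + 4) := by
      rw [Finset.mul_sum]
      refine Finset.sum_congr rfl fun j _ => ?_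
      simp only [add_assoc]; norm_num; ring
    rw [hs]
    generalize ∑ j ∈ Finset.range (m + 1),
      (m.choose (j + 3) : ℚ_[p]) / ((j + 4 : ℕ) : ℚ_[p]) * y ^ (j + 4) = S
    norm_num [c2]
    ring

theorem stmt13 (p : ℕ) [Fact p.Prime] (hp : 3 ≤ p) (q k : ℕ) (hq : 1 ≤ q) (hk : 1 ≤ k)
    (hqk : ‖(q : ℚ_[p])‖ < ‖(k : ℚ_[p])‖) (hk1 : ‖(k : ℚ_[p])‖ ≤ 1)
    (hq1 : ‖(q : ℚ_[p])‖ < 1)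
    (a : ℚ_[p]) (ha : ‖a - (1 - (q : ℚ_[p]))‖ < ‖(q : ℚ_[p])‖ ^ 2)
    (x : ℚ_[p]) (hx : ‖x - 1‖ < 1) (hxa : x ^ k = a) :
    ‖x - 1 + (q : ℚ_[p]) / (k : ℚ_[p])
        + ((k : ℚ_[p]) - 1) * (q : ℚ_[p]) ^ 2 / (2 * (k : ℚ_[p]) ^ 2)
        - ((k : ℚ_[p]) - 1) * ((k : ℚ_[p]) - 2) * (q : ℚ_[p]) ^ 3 / (6 * (k : ℚ_[p]) ^ 3)‖
      < ‖(q : ℚ_[p]) ^ 2 / (k : ℚ_[p]) ^ 2‖ := by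
  obtain ⟨R, hR, hexp⟩ := aux_exp p hp k hk (x - 1) hx
  rw [show 1 + (x - 1) = x by ring, hxa] at hexp
  have hk0 : (k : ℚ_[p]) ≠ 0 := by
    have : k ≠ 0 := by omega
    exact_mod_cast this
  have hq0 : (q : ℚ_[p]) ≠ 0 := by
    have : q ≠ 0 := by omega
    exact_mod_cast this
  have hkpos : 0 < ‖(k : ℚ_[p])‖ := norm_pos_iff.2 hk0
  have hys := aux_small p _ hx
  set y := x - 1 with hydef
  obtain ⟨t, ht⟩ : ∃ t : ℚ_[p], t = q / k := ⟨_, rfl⟩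
  obtain ⟨d, hd⟩ : ∃ d : ℚ_[p], d = (a - (1 - q)) / k := ⟨_, rfl⟩
  obtain ⟨c2, hc2⟩ : ∃ c : ℚ_[p], c = (k - 1) / 2 := ⟨_, rfl⟩
  obtain ⟨c3, hc3⟩ : ∃ c : ℚ_[p], c = (k - 1) * (k - 2) / 6 := ⟨_, rfl⟩
  have hT1 : ‖t‖ < 1 := by rw [ht, norm_div, div_lt_one hkpos]; exact hqk
  have hT0 : 0 < ‖t‖ := norm_pos_iff.2 (by rw [ht]; exact div_ne_zero hq0 hk0)
  have hTs := aux_small p t hT1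
  have hdT : ‖d‖ < ‖t‖ ^ 2 := by
    have hqt : ‖(q : ℚ_[p])‖ = ‖t‖ * ‖(k : ℚ_[p])‖ := by
      rw [← norm_mul, ht, div_mul_cancel₀ _ hk0]
    rw [hd, norm_div, div_lt_iff₀ hkpos]
    refine ha.trans_le ?_
    rw [hqt, mul_pow]
    gcongr
    exact pow_le_of_le_one (norm_nonneg _) hk1 (by norm_num)
  have hkm1 : ‖(k : ℚ_[p]) - 1‖ ≤ 1 := by
    exact_mod_cast Padic.norm_int_le_one (p := p) ((k : ℤ) - 1)
  have hkm2 : ‖(k : ℚ_[p]) - 2‖ ≤ 1 := by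
    exact_mod_cast Padic.norm_int_le_one (p := p) ((k : ℤ) - 2)
  have h2 : 1 ≤ ‖(2 : ℚ_[p])‖ := by
    have := aux_nat p 0 2 (by norm_num) (by rw [zero_add, pow_one]; omega)
    simpa using this
  have h6 : (p : ℝ)⁻¹ ≤ ‖(6 : ℚ_[p])‖ := by
    have := aux_nat p 1 6 (by norm_num) (by norm_num; nlinarith)
    simpa using this
  have h6p : 0 < ‖(6 : ℚ_[p])‖ := norm_pos_iff.2 (by norm_num)
  have hc2n : ‖c2‖ ≤ 1 := by
    rw [hc2, norm_div, div_le_one (by linarith)]; linarith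
  have hc3n : ∀ z : ℚ_[p], ‖z‖ ≤ (p : ℝ)⁻¹ → ‖c3‖ * ‖z‖ ≤ 1 := by
    intro z hz
    rw [hc3, norm_div, norm_mul, div_mul_eq_mul_div, div_le_one h6p]
    calc _ ≤ 1 * 1 * ‖z‖ := by gcongr
      _ ≤ _ := by linarith
  -- the main equation
  have heq : y + (c2 * y ^ 2 + c3 * y ^ 3 + R) = -t + d := by
    rw [hd, hexp, ht, hc2, hc3]
    field_simp
    ring
  have hA : ‖c2 * y ^ 2 + c3 * y ^ 3 + R‖ ≤ ‖y‖ ^ 2 := by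
    refine aux_add (aux_add ?_ ?_) ?_
    · rw [norm_mul, norm_pow]
      exact mul_le_of_le_one_left (by positivity) hc2n
    · rw [norm_mul, norm_pow, pow_succ' _ 2, ← mul_assoc]
      exact mul_le_of_le_one_left (by positivity) (hc3n y hys)
    · exact hR.trans (pow_le_pow_of_le_one (norm_nonneg _) hx.le (by norm_num))
  have hT2 : ‖t‖ ^ 2 ≤ ‖t‖ := pow_le_of_le_one (norm_nonneg _) hT1.le (by norm_num)
  have hT3 : ‖t‖ ^ 3 < ‖t‖ ^ 2 := by nlinarith [pow_pos hT0 2]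
  have hyT : ‖y‖ ≤ ‖t‖ := by
    by_contra hc
    push Not at hc
    have e : y = (-t + d) + -(c2 * y ^ 2 + c3 * y ^ 3 + R) := by rw [← heq]; ring
    have : ‖y‖ < ‖y‖ := by
      conv_lhs => rw [e]
      refine aux_add_lt_s13 (aux_add_lt_s13 (by rwa [norm_neg]) (by linarith)) ?_
      rw [norm_neg]
      refine hA.trans_lt ?_
      nlinarith
    exact lt_irrefl _ this
  have hyt : ‖y + t‖ ≤ ‖t‖ ^ 2 := by
    have e : y + t = d + -(c2 * y ^ 2 + c3 * y ^ 3 + R) := by linear_combination heq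
    rw [e]
    refine aux_add hdT.le ?_
    rw [norm_neg]
    exact hA.trans (pow_le_pow_left₀ (norm_nonneg _) hyT 2)
  have e : y + (q : ℚ_[p]) / k + ((k : ℚ_[p]) - 1) * (q : ℚ_[p]) ^ 2 / (2 * (k : ℚ_[p]) ^ 2)
        - ((k : ℚ_[p]) - 1) * ((k : ℚ_[p]) - 2) * (q : ℚ_[p]) ^ 3 / (6 * (k : ℚ_[p]) ^ 3)
      = d + -R + c2 * ((y + t) * (t + -y)) + -(c3 * ((y + t) * (y ^ 2 + -(y * t) + t ^ 2))) := by
    have : y + (q : ℚ_[p]) / k + ((k : ℚ_[p]) - 1) * (q : ℚ_[p]) ^ 2 / (2 * (k : ℚ_[p]) ^ 2)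
        - ((k : ℚ_[p]) - 1) * ((k : ℚ_[p]) - 2) * (q : ℚ_[p]) ^ 3 / (6 * (k : ℚ_[p]) ^ 3)
        = y + t + c2 * t ^ 2 - c3 * t ^ 3 := by
      rw [ht, hc2, hc3]; field_simp
    rw [this]
    linear_combination heq
  rw [e, ← div_pow, ← ht, norm_pow]
  refine aux_add_lt_s13 (aux_add_lt_s13 (aux_add_lt_s13 hdT ?_) ?_) ?_
  · rw [norm_neg]
    exact (hR.trans (pow_le_pow_left₀ (norm_nonneg _) hyT 3)).trans_lt hT3
  · rw [norm_mul, norm_mul]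
    refine lt_of_le_of_lt ?_ hT3
    have : ‖t + -y‖ ≤ ‖t‖ := aux_add le_rfl (by rwa [norm_neg])
    calc _ ≤ 1 * (‖t‖ ^ 2 * ‖t‖) := by gcongr
      _ = _ := by ring
  · rw [norm_neg, norm_mul, norm_mul]
    refine lt_of_le_of_lt ?_ hT3
    have : ‖y ^ 2 + -(y * t) + t ^ 2‖ ≤ ‖t‖ ^ 2 := by
      refine aux_add (aux_add ?_ ?_) ?_
      · rw [norm_pow]; gcongr
      · rw [norm_neg, norm_mul, sq]; gcongr
      · rw [norm_pow]
    calc _ ≤ ‖c3‖ * (‖t‖ ^ 2 * ‖t‖ ^ 2) := by gcongr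
      _ = (‖c3‖ * ‖t‖) * ‖t‖ ^ 3 := by ring
      _ ≤ 1 * ‖t‖ ^ 3 := by gcongr; exact hc3n t hTs
      _ = _ := one_mul _
end
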